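/- Let σ_{μν} ∈ L^∞(ℝ^n × ℝ^n) be given for each (μ,ν) ∈ ℤ^n × ℤ^n and assume: (i) sup_{μ,ν} ‖σ_{μν}‖_{L^∞} < ∞; (ii) there exists K ∈ (0,∞) such that supp σ_{μν} ⊂ (μ,ν) + KQ × KQ for all μ, ν; (iii) there exists M ∈ [0,∞) such that ‖Σ_{μ,ν∈ℤ^n} α_μ α′_ν σ_{μν}‖_{M(L²×L² → (L²,ℓ^∞))} ≤ M for all choices of α_μ ∈ {0,1} and α′_ν ∈ {0,1}. Define ⟨σ_{μν}⟩ = ∬_{ℝ^n×ℝ^n} σ_{μν}(ξ,η) dξ dη and let B be the L^∞ matrix B = (⟨σ_{μν}⟩)_{μ,ν∈ℤ^n}. Then for every Φ ∈ C_c^∞(ℝ^n × ℝ^n) there exists a constant c, depending only on n, K, Φ, such that ‖σ_{B,Φ}‖_{M(L²×L² → (L²,ℓ^∞))} ≤ cM. -/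

import Mathlib

open MeasureTheory Complex
open scoped ENNReal NNReal

noncomputable section

abbrev Rn (n : ℕ) : Type := Fin n → ℝ
abbrev Zn (n : ℕ) : Type := Fin n → ℤ

/-- Coercion of a lattice point to a point of `ℝ^n`. -/
def coeZ {n : ℕ} (μ : Zn n) : Rn n := fun i => (μ i : ℝ)

/-- The cube `aQ = [-a/2, a/2]^n`. -/
def cube (n : ℕ) (a : ℝ) : Set (Rn n) := Set.univ.pi fun _ => Set.Icc (-a / 2) (a / 2)

/-- A smooth compactly supported function. -/
def IsCcInfty {E : Type*} [NormedAddCommGroup E] [NormedSpace ℝ E] (Φ : E → ℂ) : Prop :=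
  ContDiff ℝ (⊤ : ℕ∞) Φ ∧ HasCompactSupport Φ

/-- The Fourier transform of a Schwartz function. -/
def ft {n : ℕ} (f : SchwartzMap (Rn n) ℂ) (ξ : Rn n) : ℂ :=
  ∫ x : Rn n, Complex.exp ((-2 * Real.pi * Complex.I) * ((∑ i, x i * ξ i : ℝ) : ℂ)) * f x

/-- The bilinear Fourier multiplier operator `T_σ(f,g)`. -/
def Tbil {n : ℕ} (σ : Rn n × Rn n → ℂ) (f g : SchwartzMap (Rn n) ℂ) (x : Rn n) : ℂ :=
  ∫ p : Rn n × Rn n,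
    Complex.exp ((2 * Real.pi * Complex.I) * ((∑ i, x i * (p.1 i + p.2 i) : ℝ) : ℂ)) *
      σ p * ft f p.1 * ft g p.2

/-- `L²` norm of `h(·+ν)` on the unit cube `Q`. -/
def localL2 {n : ℕ} (h : Rn n → ℂ) (ν : Zn n) : ℝ≥0∞ :=
  (∫⁻ x in cube n 1, (‖h (x + coeZ ν)‖₊ : ℝ≥0∞) ^ 2) ^ (1 / 2 : ℝ)

/-- The amalgam `(L², ℓ^q)` norm. -/
def amalgamNorm {n : ℕ} (q : ℝ≥0∞) (h : Rn n → ℂ) : ℝ≥0∞ :=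
  if q = ∞ then ⨆ ν : Zn n, localL2 h ν
  else (∑' ν : Zn n, localL2 h ν ^ q.toReal) ^ (1 / q.toReal)

/-- The multiplier norm `‖σ‖_{M(L²×L² → (L²,ℓ^q))}`. -/
def multNorm {n : ℕ} (q : ℝ≥0∞) (σ : Rn n × Rn n → ℂ) : ℝ≥0∞ :=
  ⨆ (f : SchwartzMap (Rn n) ℂ) (g : SchwartzMap (Rn n) ℂ)
    (_ : eLpNorm (⇑f) 2 volume = 1) (_ : eLpNorm (⇑g) 2 volume = 1),
    amalgamNorm q (Tbil σ f g)

/-- An `L^∞` matrix on `ℤ^n × ℤ^n`. -/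
def IsLinftyMatrix {n : ℕ} (A : Zn n → Zn n → ℂ) : Prop :=
  ∃ C : ℝ, ∀ μ ν, ‖A μ ν‖ ≤ C

/-- The norm `‖A‖_B`: the trilinear form norm over finitely supported unit `ℓ²` vectors. -/
def normB {n : ℕ} (A : Zn n → Zn n → ℂ) : ℝ≥0∞ :=
  ⨆ (F : Zn n →₀ ℂ) (G : Zn n →₀ ℂ) (H : Zn n →₀ ℂ)
    (_ : ∑ μ ∈ F.support, ‖F μ‖ ^ 2 = 1)
    (_ : ∑ ν ∈ G.support, ‖G ν‖ ^ 2 = 1)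
    (_ : ∑ ρ ∈ H.support, ‖H ρ‖ ^ 2 = 1),
    (‖∑ μ ∈ F.support, ∑ ν ∈ G.support, A μ ν * F μ * G ν * H (μ + ν)‖₊ : ℝ≥0∞)

/-- The multiplier `σ_{A,Φ}(ξ,η) = Σ_{μ,ν} a_{μν} Φ(ξ-μ, η-ν)`. -/
def sigmaA {n : ℕ} (A : Zn n → Zn n → ℂ) (Φ : Rn n × Rn n → ℂ) (p : Rn n × Rn n) : ℂ :=
  ∑' μν : Zn n × Zn n, A μν.1 μν.2 * Φ (p.1 - coeZ μν.1, p.2 - coeZ μν.2)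

/-- Condition (A) for functions on `ℝ^d`. -/
def ConditionA {d : ℕ} (Φ : Rn d → ℂ) : Prop :=
  ∃ Θ : Rn d → ℂ, ContDiff ℝ (⊤ : ℕ∞) Θ ∧ HasCompactSupport Θ ∧
    ∀ α : Zn d, (∫ x : Rn d, Θ x * Φ (x - coeZ α)) = if α = 0 then 1 else 0

/-- Condition (A) for functions on `ℝ^n × ℝ^n` (i.e. `d = 2n`). -/
def ConditionA2 {n : ℕ} (Φ : Rn n × Rn n → ℂ) : Prop :=
  ∃ Θ : Rn n × Rn n → ℂ, ContDiff ℝ (⊤ : ℕ∞) Θ ∧ HasCompactSupport Θ ∧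
    ∀ α β : Zn n, (∫ p : Rn n × Rn n, Θ p * Φ (p.1 - coeZ α, p.2 - coeZ β)) =
      if α = 0 ∧ β = 0 then 1 else 0

/-- Condition (A) for functions on `ℝ` (the case `d = 1`). -/
def ConditionA1 (Φ : ℝ → ℂ) : Prop :=
  ∃ θ : ℝ → ℂ, ContDiff ℝ (⊤ : ℕ∞) θ ∧ HasCompactSupport θ ∧
    ∀ j : ℤ, (∫ x : ℝ, θ x * Φ (x - (j : ℝ))) = if j = 0 then 1 else 0

/-- The `L^∞` (sup) norm, valued in `ℝ≥0∞`. -/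
def supNorm {E : Type*} (u : E → ℂ) : ℝ≥0∞ := ⨆ x, (‖u x‖₊ : ℝ≥0∞)

end

open scoped FourierTransform SchwartzMap

theorem volume_preserving_euclideanEquiv (n : ℕ) :
    MeasurePreserving (EuclideanSpace.equiv (Fin n) ℝ) :=
  PiLp.volume_preserving_ofLp (Fin n)

/-- Transport of Schwartz functions from `ℝ^n` to the Euclidean space. -/
noncomputable def schwartzToEuclidean {n : ℕ} (f : SchwartzMap (Rn n) ℂ) :
    SchwartzMap (EuclideanSpace ℝ (Fin n)) ℂ :=
  SchwartzMap.compCLMOfContinuousLinearEquiv ℂ (EuclideanSpace.equiv (Fin n) ℝ) f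

theorem ft_eq_fourier {n : ℕ} (f : SchwartzMap (Rn n) ℂ) (ξ : Rn n) :
    ft f ξ = (𝓕 (schwartzToEuclidean f)) ((EuclideanSpace.equiv (Fin n) ℝ).symm ξ) := by
  rw [SchwartzMap.fourier_coe, Real.fourier_eq']
  unfold ft
  rw [← (volume_preserving_euclideanEquiv n).integral_comp
    (EuclideanSpace.equiv (Fin n) ℝ).toHomeomorph.measurableEmbedding]
  congr 1
  ext x
  simp only [schwartzToEuclidean, SchwartzMap.compCLMOfContinuousLinearEquiv_apply, Function.comp,
    smul_eq_mul]
  congr 2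
  simp [PiLp.inner_apply, mul_comm]
  ring

/-- The Fourier transform of a Schwartz function as a Schwartz function. -/
noncomputable def ftSchwartz {n : ℕ} (f : SchwartzMap (Rn n) ℂ) : SchwartzMap (Rn n) ℂ :=
  SchwartzMap.compCLMOfContinuousLinearEquiv ℂ (EuclideanSpace.equiv (Fin n) ℝ).symm
    (𝓕 (schwartzToEuclidean f))

theorem coe_ftSchwartz {n : ℕ} (f : SchwartzMap (Rn n) ℂ) : ⇑(ftSchwartz f) = ft f := by
  ext ξ
  rw [ft_eq_fourier]
  rfl

theorem exists_ft_eq {n : ℕ} {u : Rn n → ℂ} (hu : ContDiff ℝ (⊤ : ℕ∞) u)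
    (hc : HasCompactSupport u) : ∃ f : SchwartzMap (Rn n) ℂ, ft f = u := by
  refine ⟨SchwartzMap.compCLMOfContinuousLinearEquiv ℂ (EuclideanSpace.equiv (Fin n) ℝ).symm
    (𝓕⁻ (schwartzToEuclidean (hc.toSchwartzMap hu))), ?_⟩
  ext ξ
  rw [ft_eq_fourier]
  have : schwartzToEuclidean (SchwartzMap.compCLMOfContinuousLinearEquiv ℂ
      (EuclideanSpace.equiv (Fin n) ℝ).symm (𝓕⁻ (schwartzToEuclidean (hc.toSchwartzMap hu)))) =
      𝓕⁻ (schwartzToEuclidean (hc.toSchwartzMap hu)) := by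
    ext x; rfl
  rw [this, FourierTransform.fourier_fourierInv_eq]
  rfl

theorem lintegral_enorm_sq_ft {n : ℕ} (f : SchwartzMap (Rn n) ℂ) :
    ∫⁻ ξ, ‖ft f ξ‖ₑ ^ 2 = ∫⁻ x, ‖f x‖ₑ ^ 2 := by
  have key : ∀ h : SchwartzMap (EuclideanSpace ℝ (Fin n)) ℂ,
      ∫⁻ x, ‖h x‖ₑ ^ 2 = ENNReal.ofReal (∫ x, ‖h x‖ ^ 2) := by
    intro h
    rw [ofReal_integral_eq_lintegral_ofReal]
    · simp_rw [← ofReal_norm, ENNReal.ofReal_pow (norm_nonneg _)]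
    · exact (h.memLp 2).integrable_norm_pow (by norm_num)
    · exact Filter.Eventually.of_forall fun x => by positivity
  have e1 := (volume_preserving_euclideanEquiv n).lintegral_comp_emb
    (EuclideanSpace.equiv (Fin n) ℝ).toHomeomorph.measurableEmbedding
  rw [← e1 fun ξ => ‖ft f ξ‖ₑ ^ 2, ← e1 fun ξ => ‖f ξ‖ₑ ^ 2]
  have e2 : ∀ x, ft f (EuclideanSpace.equiv (Fin n) ℝ x) = (𝓕 (schwartzToEuclidean f)) x := fun x => by
    rw [ft_eq_fourier]; rfl
  simp_rw [e2]
  have e3 : ∀ x, f (EuclideanSpace.equiv (Fin n) ℝ x) = (schwartzToEuclidean f) x := fun x => rfl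
  simp_rw [e3]
  rw [key, key, SchwartzMap.integral_norm_sq_fourier]

theorem eLpNorm_two_sq {α : Type*} [MeasurableSpace α] (μ : Measure α) (h : α → ℂ) :
    eLpNorm h 2 μ ^ 2 = ∫⁻ x, ‖h x‖ₑ ^ 2 ∂μ := by
  have := eLpNorm_nnreal_pow_eq_lintegral (f := h) (p := 2) (μ := μ) (by norm_num)
  simpa using this

theorem ft_smul {n : ℕ} (a : ℂ) (f : SchwartzMap (Rn n) ℂ) (ξ : Rn n) :
    ft (a • f) ξ = a * ft f ξ := by
  unfold ft
  rw [← integral_const_mul]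
  congr 1
  ext x
  simp only [smul_apply, smul_eq_mul]
  ring

theorem Tbil_smul_smul {n : ℕ} (σ : Rn n × Rn n → ℂ) (a b : ℂ) (f g : SchwartzMap (Rn n) ℂ)
    (x : Rn n) : Tbil σ (a • f) (b • g) x = a * b * Tbil σ f g x := by
  unfold Tbil
  rw [← integral_const_mul]
  congr 1
  ext p
  rw [ft_smul, ft_smul]
  ring

theorem localL2_sq {n : ℕ} (h : Rn n → ℂ) (ν : Zn n) :
    localL2 h ν ^ 2 = ∫⁻ x in cube n 1, ‖h (x + coeZ ν)‖ₑ ^ 2 := by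
  unfold localL2
  rw [← ENNReal.rpow_natCast, ← ENNReal.rpow_mul]
  norm_num
  rfl

theorem localL2_const_mul {n : ℕ} (c : ℂ) (h : Rn n → ℂ) (ν : Zn n) :
    localL2 (fun x => c * h x) ν = ‖c‖ₑ * localL2 h ν := by
  rw [← ENNReal.pow_right_strictMono two_ne_zero |>.injective.eq_iff, mul_pow, localL2_sq,
    localL2_sq, ← lintegral_const_mul' _ _ (by finiteness)]
  simp_rw [enorm_mul, mul_pow]

theorem ft_eq_zero_of_eLpNorm_eq_zero {n : ℕ} {f : SchwartzMap (Rn n) ℂ}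
    (hf : eLpNorm f 2 volume = 0) (ξ : Rn n) : ft f ξ = 0 := by
  rw [eLpNorm_eq_zero_iff f.continuous.aestronglyMeasurable (by norm_num)] at hf
  unfold ft
  rw [← integral_zero (Rn n) ℂ]
  apply integral_congr_ae
  filter_upwards [hf] with x hx
  rw [hx]
  simp

theorem localL2_eq_zero {n : ℕ} {h : Rn n → ℂ} (hh : ∀ x, h x = 0) (ν : Zn n) :
    localL2 h ν = 0 := by
  simp [localL2, hh]

theorem exists_normalized {n : ℕ} {f : SchwartzMap (Rn n) ℂ} (hf : eLpNorm f 2 volume ≠ 0) :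
    ∃ a : ℂ, eLpNorm (⇑(a • f)) 2 volume = 1 ∧ ‖a‖ₑ * eLpNorm f 2 volume = 1 := by
  have hfin : eLpNorm f 2 volume ≠ ∞ := (f.memLp 2 volume).2.ne
  have hpos : 0 < (eLpNorm f 2 volume).toReal := ENNReal.toReal_pos hf hfin
  have : ‖((((eLpNorm f 2 volume).toReal)⁻¹ : ℝ) : ℂ)‖ₑ * eLpNorm f 2 volume = 1 := by
    rw [← ofReal_norm, Complex.norm_real, Real.norm_of_nonneg (by positivity),
      ENNReal.ofReal_inv_of_pos hpos, ENNReal.ofReal_toReal hfin, ENNReal.inv_mul_cancel hf hfin]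
  refine ⟨_, ?_, this⟩
  exact (eLpNorm_const_smul _ (⇑f) 2 volume).trans this

/-- The multiplier norm bounds the operator on arbitrary Schwartz functions. -/
theorem localL2_Tbil_le {n : ℕ} (σ : Rn n × Rn n → ℂ) (f g : SchwartzMap (Rn n) ℂ) (ν : Zn n) :
    localL2 (Tbil σ f g) ν ≤ multNorm ⊤ σ * (eLpNorm f 2 volume * eLpNorm g 2 volume) := by
  by_cases hf : eLpNorm f 2 volume = 0
  · rw [localL2_eq_zero fun x => by simp [Tbil, ft_eq_zero_of_eLpNorm_eq_zero hf]]
    exact zero_le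
  by_cases hg : eLpNorm g 2 volume = 0
  · rw [localL2_eq_zero fun x => by simp [Tbil, ft_eq_zero_of_eLpNorm_eq_zero hg]]
    exact zero_le
  obtain ⟨a, ha, ha'⟩ := exists_normalized hf
  obtain ⟨b, hb, hb'⟩ := exists_normalized hg
  have h1 : localL2 (Tbil σ (a • f) (b • g)) ν ≤ multNorm ⊤ σ := by
    have : amalgamNorm ⊤ (Tbil σ (a • f) (b • g)) ≤ multNorm ⊤ σ := by
      unfold multNorm
      generalize a • f = u at ha ⊢
      generalize b • g = v at hb ⊢
      refine le_trans ?_ (le_iSup _ u)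
      refine le_trans ?_ (le_iSup _ v)
      simp only [ha, hb, ciSup_unique, le_refl]
    refine le_trans ?_ this
    simp only [amalgamNorm, if_true]
    exact le_iSup (fun ν => localL2 (Tbil σ (a • f) (b • g)) ν) ν
  have h2 : localL2 (Tbil σ (a • f) (b • g)) ν = ‖a * b‖ₑ * localL2 (Tbil σ f g) ν := by
    rw [← localL2_const_mul]
    congr 1
    ext x
    exact Tbil_smul_smul ..
  calc localL2 (Tbil σ f g) ν
      = (‖a‖ₑ * eLpNorm f 2 volume) * (‖b‖ₑ * eLpNorm g 2 volume) * localL2 (Tbil σ f g) ν := by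
        rw [ha', hb']; simp
    _ = (‖a * b‖ₑ * localL2 (Tbil σ f g) ν) * (eLpNorm f 2 volume * eLpNorm g 2 volume) := by
        rw [enorm_mul]; ring
    _ ≤ _ := by
        rw [← h2]; gcongr

open Finset in
theorem exists_card_lattice_le (n : ℕ) (R : ℝ) : ∃ C : ℕ, ∀ (x : Rn n) (S : Finset (Zn n)),
    (∀ μ ∈ S, ‖x - coeZ μ‖ ≤ R) → #S ≤ C := by
  refine ⟨(⌊2 * R⌋ + 1).toNat ^ n, fun x S hS => ?_⟩
  have hsub : S ⊆ Fintype.piFinset fun i => Icc ⌈x i - R⌉ ⌊x i + R⌋ := by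
    intro μ hμ
    rw [Fintype.mem_piFinset]
    intro i
    have h1 := (norm_le_pi_norm (x - coeZ μ) i).trans (hS μ hμ)
    rw [Real.norm_eq_abs, abs_le] at h1
    simp only [Pi.sub_apply, coeZ] at h1
    rw [mem_Icc, Int.ceil_le, Int.le_floor]
    constructor <;> linarith
  refine (card_le_card hsub).trans ?_
  rw [Fintype.card_piFinset]
  refine (prod_le_pow_card _ _ (⌊2 * R⌋ + 1).toNat ?_).trans (by simp)
  intro i _
  rw [Int.card_Icc]
  apply Int.toNat_le_toNat
  have : ⌊x i + R⌋ - ⌈x i - R⌉ ≤ ⌊2 * R⌋ := by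
    rw [Int.le_floor]
    push_cast
    linarith [Int.floor_le (x i + R), Int.le_ceil (x i - R)]
  linarith

/-- The character `e^{2πi x·ξ}`. -/
noncomputable def chr {n : ℕ} (x ξ : Rn n) : ℂ :=
  cexp ((2 * Real.pi * I) * ((∑ i, x i * ξ i : ℝ) : ℂ))

theorem norm_chr {n : ℕ} (x ξ : Rn n) : ‖chr x ξ‖ = 1 := by
  rw [chr, show (2 * Real.pi * I) * ((∑ i, x i * ξ i : ℝ) : ℂ) =
    ((2 * Real.pi * ∑ i, x i * ξ i : ℝ) : ℂ) * I by push_cast; ring]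
  exact norm_exp_ofReal_mul_I _

theorem chr_add_right {n : ℕ} (x ξ η : Rn n) : chr x (ξ + η) = chr x ξ * chr x η := by
  rw [chr, chr, chr, ← Complex.exp_add]
  congr 1
  simp only [Pi.add_apply, mul_add, Finset.sum_add_distrib]
  push_cast
  ring

theorem chr_add_left {n : ℕ} (x y ξ : Rn n) : chr (x + y) ξ = chr x ξ * chr y ξ := by
  rw [chr, chr, chr, ← Complex.exp_add]
  congr 1
  simp only [Pi.add_apply, add_mul, Finset.sum_add_distrib]
  push_cast
  ring

theorem chr_neg_mul_self {n : ℕ} (x ξ : Rn n) : chr (-x) ξ * chr x ξ = 1 := by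
  rw [← chr_add_left]
  simp [chr]

theorem contDiff_chr {n : ℕ} (x : Rn n) : ContDiff ℝ (⊤ : ℕ∞) (chr x) := by
  unfold chr
  have : ContDiff ℝ (⊤ : ℕ∞) fun ξ : Rn n => ∑ i, x i * ξ i := by fun_prop
  exact (contDiff_const.mul (ofRealCLM.contDiff.comp this)).cexp

theorem continuous_chr {n : ℕ} : Continuous fun q : Rn n × Rn n => chr q.1 q.2 := by
  unfold chr
  fun_prop

/-- The Taylor polynomial of `e^{-2πi t·ζ}`. -/
noncomputable def expTaylor {n : ℕ} (k : ℕ) (t ζ : Rn n) : ℂ :=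
  ∑ j ∈ Finset.range k, (-(2 * Real.pi * I) * ((∑ i, t i * ζ i : ℝ) : ℂ)) ^ j / (j.factorial : ℂ)

theorem continuous_expTaylor {n : ℕ} (k : ℕ) (t : Rn n) : Continuous (expTaylor k t) := by
  unfold expTaylor
  fun_prop

theorem tendsto_expTaylor {n : ℕ} (t ζ : Rn n) :
    Filter.Tendsto (fun k => expTaylor k t ζ) Filter.atTop (nhds (chr (-t) ζ)) := by
  have h := (NormedSpace.expSeries_div_hasSum_exp (𝔸 := ℂ)
    (-(2 * Real.pi * I) * ((∑ i, t i * ζ i : ℝ) : ℂ))).tendsto_sum_nat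
  rw [← Complex.exp_eq_exp_ℂ] at h
  have e : cexp (-(2 * Real.pi * I) * ((∑ i, t i * ζ i : ℝ) : ℂ)) = chr (-t) ζ := by
    unfold chr
    congr 1
    simp
  rw [e] at h
  exact h

theorem norm_expTaylor_le {n : ℕ} (k : ℕ) (t ζ : Rn n) :
    ‖expTaylor k t ζ‖ ≤ Real.exp (2 * Real.pi * |∑ i, t i * ζ i|) := by
  unfold expTaylor
  refine (norm_sum_le _ _).trans ?_
  refine le_trans (le_of_eq ?_) (Real.sum_le_exp_of_nonneg (by positivity) k)
  refine Finset.sum_congr rfl fun j _ => ?_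
  rw [norm_div, norm_pow, norm_mul, Complex.norm_real]
  simp [abs_of_pos Real.pi_pos]

/-- Monomials, scaled to be bounded by `1` on the ball of radius `R`. -/
noncomputable def scaledMonomial {n : ℕ} (R : ℝ) {k : ℕ} (p : Fin k → Fin n) (ζ : Rn n) : ℂ :=
  ∏ l, ((ζ (p l) / R : ℝ) : ℂ)

theorem contDiff_scaledMonomial {n : ℕ} (R : ℝ) {k : ℕ} (p : Fin k → Fin n) :
    ContDiff ℝ (⊤ : ℕ∞) (scaledMonomial R p) := by
  unfold scaledMonomial
  refine contDiff_prod fun l _ => ofRealCLM.contDiff.comp ?_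
  have : ContDiff ℝ (⊤ : ℕ∞) fun ζ : Rn n => ζ (p l) := by fun_prop
  exact this.div_const R

theorem norm_scaledMonomial_le {n : ℕ} {R : ℝ} (hR : 0 < R) {k : ℕ} (p : Fin k → Fin n)
    {ζ : Rn n} (hζ : ‖ζ‖ ≤ R) : ‖scaledMonomial R p ζ‖ ≤ 1 := by
  unfold scaledMonomial
  rw [norm_prod]
  refine Finset.prod_le_one (fun _ _ => norm_nonneg _) fun l _ => ?_
  rw [Complex.norm_real, norm_div, Real.norm_of_nonneg hR.le, div_le_one hR]
  exact (norm_le_pi_norm ζ _).trans hζ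

/-- The coefficients of `scaledMonomial` in `expTaylor`. -/
noncomputable def taylorCoeff {n : ℕ} (R : ℝ) {k : ℕ} (p : Fin k → Fin n) (t : Rn n) : ℂ :=
  (-(2 * Real.pi * I) * R) ^ k / (k.factorial : ℂ) * ∏ l, (t (p l) : ℂ)

theorem continuous_taylorCoeff {n : ℕ} (R : ℝ) {k : ℕ} (p : Fin k → Fin n) :
    Continuous (taylorCoeff R p) := by
  unfold taylorCoeff
  fun_prop

theorem norm_le_one_of_mem_cube {n : ℕ} {t : Rn n} (ht : t ∈ cube n 1) : ‖t‖ ≤ 1 := by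
  rw [pi_norm_le_iff_of_nonneg zero_le_one]
  intro i
  have := ht i (Set.mem_univ i)
  rw [Real.norm_eq_abs, abs_le]
  constructor <;> linarith [this.1, this.2]

theorem norm_taylorCoeff_le {n : ℕ} {R : ℝ} (hR : 0 < R) {k : ℕ} (p : Fin k → Fin n)
    {t : Rn n} (ht : t ∈ cube n 1) :
    ‖taylorCoeff R p t‖ ≤ (2 * Real.pi * R) ^ k / (k.factorial : ℝ) := by
  unfold taylorCoeff
  rw [norm_mul, norm_prod]
  have h1 : ∏ l, ‖(t (p l) : ℂ)‖ ≤ 1 := by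
    refine Finset.prod_le_one (fun _ _ => norm_nonneg _) fun l _ => ?_
    rw [Complex.norm_real]
    exact (norm_le_pi_norm t _).trans (norm_le_one_of_mem_cube ht)
  have h2 : ‖(-(2 * Real.pi * I) * R) ^ k / (k.factorial : ℂ)‖ =
      (2 * Real.pi * R) ^ k / (k.factorial : ℝ) := by
    simp [abs_of_pos Real.pi_pos, abs_of_pos hR]
  rw [h2]
  exact mul_le_of_le_one_right (by positivity) h1

theorem expTaylor_eq_sum {n : ℕ} {R : ℝ} (hR : 0 < R) (k : ℕ) (t ζ : Rn n) :
    expTaylor k t ζ =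
      ∑ J : (j : Fin k) × (Fin j → Fin n), taylorCoeff R J.2 t * scaledMonomial R J.2 ζ := by
  rw [Fintype.sum_sigma, expTaylor, Finset.sum_range]
  refine Finset.sum_congr rfl fun j _ => ?_
  have : ((∑ i, t i * ζ i : ℝ) : ℂ) = R * ∑ i, (t i : ℂ) * ((ζ i / R : ℝ) : ℂ) := by
    push_cast
    rw [Finset.mul_sum]
    refine Finset.sum_congr rfl fun i _ => ?_
    have : (R : ℂ) ≠ 0 := by exact_mod_cast hR.ne'
    field_simp
  rw [this, ← mul_assoc, mul_pow, Fintype.sum_pow, mul_div_right_comm, Finset.mul_sum]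
  refine Finset.sum_congr rfl fun p _ => ?_
  rw [taylorCoeff, scaledMonomial, Finset.prod_mul_distrib]
  ring

theorem sum_taylorCoeff_bound_le {n : ℕ} {R : ℝ} (hR : 0 < R) (k : ℕ) :
    ∑ J : (j : Fin k) × (Fin j → Fin n), (2 * Real.pi * R) ^ (J.1 : ℕ) / ((J.1 : ℕ).factorial : ℝ)
      ≤ Real.exp (2 * Real.pi * R * n) := by
  rw [Fintype.sum_sigma]
  refine le_trans (le_of_eq ?_) (Real.sum_le_exp_of_nonneg (by positivity) k)
  rw [Finset.sum_range]
  refine Finset.sum_congr rfl fun j _ => ?_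
  simp only [Finset.sum_const, Finset.card_univ, Fintype.card_fun, Fintype.card_fin, nsmul_eq_mul]
  push_cast
  ring

/-- A finite set of lattice points whose closed `R`-balls are pairwise disjoint. -/
def LatSep {n : ℕ} (R : ℝ) (S : Finset (Zn n)) : Prop :=
  ∀ μ ∈ S, ∀ ν ∈ S, μ ≠ ν → 2 * R < ‖coeZ μ - coeZ ν‖

/-- The `ℓ²` norm over a finite set. -/
noncomputable def ell2 {ι : Type*} (S : Finset ι) (F : ι → ℂ) : ℝ≥0∞ :=
  (∑ μ ∈ S, ‖F μ‖ₑ ^ 2) ^ (1 / 2 : ℝ)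

theorem ennreal_sqrt_sq (a : ℝ≥0∞) : (a ^ (1 / 2 : ℝ)) ^ 2 = a := by
  rw [← ENNReal.rpow_natCast, ← ENNReal.rpow_mul]
  norm_num

theorem ell2_sq {ι : Type*} (S : Finset ι) (F : ι → ℂ) :
    ell2 S F ^ 2 = ∑ μ ∈ S, ‖F μ‖ₑ ^ 2 :=
  ennreal_sqrt_sq _

theorem ennreal_le_of_sq_le {a b : ℝ≥0∞} (h : a ^ 2 ≤ b ^ 2) : a ≤ b :=
  (ENNReal.pow_right_strictMono two_ne_zero).le_iff_le.1 h

theorem LatSep.sum_eq {n : ℕ} {R : ℝ} {S : Finset (Zn n)} (hS : LatSep R S) {φ : Rn n → ℂ}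
    (hφ : ∀ ζ, φ ζ ≠ 0 → ‖ζ‖ ≤ R) (F : Zn n → ℂ) {μ : Zn n} (hμ : μ ∈ S) {ξ : Rn n}
    (hξ : ‖ξ - coeZ μ‖ ≤ R) :
    ∑ μ' ∈ S, F μ' * φ (ξ - coeZ μ') = F μ * φ (ξ - coeZ μ) := by
  refine Finset.sum_eq_single_of_mem μ hμ fun ν hν hne => ?_
  by_contra h
  have h1 := hφ _ (right_ne_zero_of_mul h)
  have h2 := hS ν hν μ hμ hne
  have h3 : coeZ ν - coeZ μ = (ξ - coeZ μ) - (ξ - coeZ ν) := by abel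
  rw [h3] at h2
  linarith [norm_sub_le (ξ - coeZ μ) (ξ - coeZ ν)]

theorem LatSep.exists_schwartz {n : ℕ} {R : ℝ} {S : Finset (Zn n)} (hS : LatSep R S)
    {φ : Rn n → ℂ} (hφs : ContDiff ℝ (⊤ : ℕ∞) φ) (hφ : ∀ ζ, φ ζ ≠ 0 → ‖ζ‖ ≤ R)
    (hφ1 : ∀ ζ, ‖φ ζ‖ ≤ 1) (F : Zn n → ℂ) :
    ∃ f : SchwartzMap (Rn n) ℂ, (∀ ξ, ft f ξ = ∑ μ ∈ S, F μ * φ (ξ - coeZ μ)) ∧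
      eLpNorm f 2 volume ≤
        volume (Metric.closedBall (0 : Rn n) R) ^ (1 / 2 : ℝ) * ell2 S F := by
  set u : Rn n → ℂ := fun ξ => ∑ μ ∈ S, F μ * φ (ξ - coeZ μ) with hu
  have hus : ContDiff ℝ (⊤ : ℕ∞) u :=
    ContDiff.sum fun μ _ => contDiff_const.mul (hφs.comp (contDiff_id.sub contDiff_const))
  have huc : HasCompactSupport u := by
    apply HasCompactSupport.of_support_subset_isCompact
      (K := ⋃ μ ∈ S, Metric.closedBall (coeZ μ) R)
    · exact S.isCompact_biUnion fun μ _ => isCompact_closedBall _ _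
    · intro ξ hξ
      obtain ⟨μ, hμ, hne⟩ := Finset.exists_ne_zero_of_sum_ne_zero hξ
      simp only [Set.mem_iUnion]
      exact ⟨μ, hμ, by rw [mem_closedBall_iff_norm]; exact hφ _ (right_ne_zero_of_mul hne)⟩
  obtain ⟨f, hf⟩ := exists_ft_eq hus huc
  refine ⟨f, fun ξ => by rw [hf], ennreal_le_of_sq_le ?_⟩
  rw [eLpNorm_two_sq, ← lintegral_enorm_sq_ft, hf, mul_pow, ennreal_sqrt_sq, ell2_sq]
  calc ∫⁻ ξ, ‖u ξ‖ₑ ^ 2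
      ≤ ∫⁻ ξ, ∑ μ ∈ S, ‖F μ‖ₑ ^ 2 * (Metric.closedBall (coeZ μ) R).indicator 1 ξ := by
        refine lintegral_mono fun ξ => ?_
        by_cases h : ∃ μ ∈ S, ‖ξ - coeZ μ‖ ≤ R
        · obtain ⟨μ, hμ, hξ⟩ := h
          rw [show u ξ = F μ * φ (ξ - coeZ μ) from hS.sum_eq hφ F hμ hξ]
          refine le_trans ?_ (Finset.single_le_sum (f := fun μ => ‖F μ‖ₑ ^ 2 *
            (Metric.closedBall (coeZ μ) R).indicator 1 ξ) (fun _ _ => zero_le) hμ)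
          simp only
          rw [Set.indicator_of_mem (by rwa [mem_closedBall_iff_norm]), enorm_mul, mul_pow]
          gcongr
          have : ‖φ (ξ - coeZ μ)‖ₑ ≤ 1 := by
            rw [← ofReal_norm]; simpa using ENNReal.ofReal_le_ofReal (hφ1 (ξ - coeZ μ))
          exact pow_le_one₀ zero_le this
        · push Not at h
          have : u ξ = 0 := by
            refine Finset.sum_eq_zero fun μ hμ => ?_
            by_contra hne
            exact absurd (hφ _ (right_ne_zero_of_mul hne)) (not_le.2 (h μ hμ))
          rw [this]
          simp
    _ = ∑ μ ∈ S, ‖F μ‖ₑ ^ 2 * volume (Metric.closedBall (coeZ μ) R) := by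
        rw [lintegral_finsetSum]
        · refine Finset.sum_congr rfl fun μ _ => ?_
          rw [lintegral_const_mul _ (measurable_one.indicator measurableSet_closedBall),
            lintegral_indicator_one measurableSet_closedBall]
        · exact fun μ _ => (measurable_one.indicator measurableSet_closedBall).const_mul _
    _ = volume (Metric.closedBall (0 : Rn n) R) * ∑ μ ∈ S, ‖F μ‖ₑ ^ 2 := by
        rw [Finset.mul_sum]
        refine Finset.sum_congr rfl fun μ _ => ?_
        rw [mul_comm, Measure.addHaar_closedBall_center]

/-- A family of bounded symbols localized near the lattice points, with unconditional multiplier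
bound `M`. -/
structure LocalizedFamily {n : ℕ} (K C : ℝ) (M : ℝ≥0) (σf : Zn n → Zn n → Rn n × Rn n → ℂ) :
    Prop where
  meas : ∀ μ ν, Measurable (σf μ ν)
  bound : ∀ μ ν p, ‖σf μ ν p‖ ≤ C
  supp : ∀ μ ν, ∀ p : Rn n × Rn n, σf μ ν p ≠ 0 →
    p.1 - coeZ μ ∈ cube n K ∧ p.2 - coeZ ν ∈ cube n K
  mult : ∀ α α' : Zn n → ℂ, (∀ μ, α μ = 0 ∨ α μ = 1) → (∀ ν, α' ν = 0 ∨ α' ν = 1) →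
    multNorm ⊤ (fun p : Rn n × Rn n =>
      ∑' μν : Zn n × Zn n, α μν.1 * α' μν.2 * σf μν.1 μν.2 p) ≤ (M : ℝ≥0∞)

theorem norm_le_of_mem_cube {n : ℕ} {K : ℝ} (hK : 0 < K) {t : Rn n} (ht : t ∈ cube n K) :
    ‖t‖ ≤ K := by
  rw [pi_norm_le_iff_of_nonneg hK.le]
  intro i
  have := ht i (Set.mem_univ i)
  rw [Real.norm_eq_abs, abs_le]
  constructor <;> linarith [this.1, this.2]

namespace LocalizedFamily

variable {n : ℕ} {K C : ℝ} {M : ℝ≥0} {σf : Zn n → Zn n → Rn n × Rn n → ℂ}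

theorem integrable (h : LocalizedFamily K C M σf) (hK : 0 < K) (μ ν : Zn n) :
    Integrable (σf μ ν) := by
  have hs : Function.support (σf μ ν) ⊆ Metric.closedBall (coeZ μ, coeZ ν) K := by
    intro p hp
    obtain ⟨h1, h2⟩ := h.supp μ ν p hp
    rw [← closedBall_prod_same]
    exact ⟨mem_closedBall_iff_norm.2 (norm_le_of_mem_cube hK h1),
      mem_closedBall_iff_norm.2 (norm_le_of_mem_cube hK h2)⟩
  rw [← integrableOn_iff_integrable_of_support_subset hs]
  exact Measure.integrableOn_of_bounded (M := C) (measure_closedBall_lt_top).ne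
    (h.meas μ ν).aestronglyMeasurable (Filter.Eventually.of_forall (h.bound μ ν))

theorem integrable_mul (h : LocalizedFamily K C M σf) (hK : 0 < K) (μ ν : Zn n)
    {w : Rn n × Rn n → ℂ} (hw : Continuous w) {D : ℝ} (hD : ∀ p, ‖w p‖ ≤ D) :
    Integrable fun p => σf μ ν p * w p :=
  (h.integrable hK μ ν).mul_bdd (c := D) hw.aestronglyMeasurable (Filter.Eventually.of_forall hD)

/-- The bilinear operator tested on sums of translates of `φ` and `ψ`. -/
noncomputable def _root_.testForm (σf : Zn n → Zn n → Rn n × Rn n → ℂ) (S S' : Finset (Zn n))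
    (F G : Zn n → ℂ) (φ ψ : Rn n → ℂ) (x : Rn n) : ℂ :=
  ∑ μ ∈ S, ∑ ν ∈ S', F μ * G ν *
    ∫ p : Rn n × Rn n, σf μ ν p *
      (chr x (p.1 + p.2) * (φ (p.1 - coeZ μ) * ψ (p.2 - coeZ ν)))

theorem localL2_testForm_le (h : LocalizedFamily K C M σf) (hK : 0 < K) {R : ℝ} (hR : K ≤ R)
    {S S' : Finset (Zn n)} (hS : LatSep R S) (hS' : LatSep R S') {φ ψ : Rn n → ℂ}
    (hφs : ContDiff ℝ (⊤ : ℕ∞) φ) (hφ : ∀ ζ, φ ζ ≠ 0 → ‖ζ‖ ≤ R) (hφ1 : ∀ ζ, ‖φ ζ‖ ≤ 1)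
    (hψs : ContDiff ℝ (⊤ : ℕ∞) ψ) (hψ : ∀ ζ, ψ ζ ≠ 0 → ‖ζ‖ ≤ R) (hψ1 : ∀ ζ, ‖ψ ζ‖ ≤ 1)
    (F G : Zn n → ℂ) (ρ : Zn n) :
    localL2 (testForm σf S S' F G φ ψ) ρ ≤
      M * volume (Metric.closedBall (0 : Rn n) R) * (ell2 S F * ell2 S' G) := by
  classical
  obtain ⟨f, hf, hfn⟩ := hS.exists_schwartz hφs hφ hφ1 F
  obtain ⟨g, hg, hgn⟩ := hS'.exists_schwartz hψs hψ hψ1 G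
  set α : Zn n → ℂ := fun μ => if μ ∈ S then 1 else 0 with hα
  set α' : Zn n → ℂ := fun μ => if μ ∈ S' then 1 else 0 with hα'
  have hM := h.mult α α' (fun μ => by by_cases hm : μ ∈ S <;> simp [hα, hm])
    (fun μ => by by_cases hm : μ ∈ S' <;> simp [hα', hm])
  set τ : Rn n × Rn n → ℂ := fun p : Rn n × Rn n =>
      ∑' μν : Zn n × Zn n, α μν.1 * α' μν.2 * σf μν.1 μν.2 p with hτ
  have hτ' : ∀ p, τ p = ∑ μ ∈ S, ∑ ν ∈ S', σf μ ν p := by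
    intro p
    rw [hτ]
    simp only
    rw [tsum_eq_sum (s := S ×ˢ S'), Finset.sum_product]
    · refine Finset.sum_congr rfl fun μ hμ => Finset.sum_congr rfl fun ν hν => ?_
      simp [hα, hα', hμ, hν]
    · intro μν hμν
      rw [Finset.mem_product, not_and_or] at hμν
      rcases hμν with h1 | h1 <;> simp [hα, hα', h1]
  have hT : ∀ x, Tbil τ f g x = testForm σf S S' F G φ ψ x := by
    intro x
    unfold Tbil testForm
    have hFG : ∀ μ ν, Integrable fun p : Rn n × Rn n => F μ * G ν * (σf μ ν p *
        (chr x (p.1 + p.2) * (φ (p.1 - coeZ μ) * ψ (p.2 - coeZ ν)))) := by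
      intro μ ν
      refine (h.integrable_mul hK μ ν (D := 1) ?_ ?_).const_mul _
      · have h1 := hφs.continuous
        have h2 := hψs.continuous
        have h3 : Continuous fun p : Rn n × Rn n => chr x (p.1 + p.2) :=
          (contDiff_chr x).continuous.comp (by fun_prop)
        fun_prop
      · intro p
        rw [norm_mul, norm_mul, norm_chr, one_mul]
        exact mul_le_one₀ (hφ1 _) (norm_nonneg _) (hψ1 _)
    simp_rw [← integral_const_mul]
    have e1 : ∀ p : Rn n × Rn n,
        cexp ((2 * Real.pi * I) * ((∑ i, x i * (p.1 i + p.2 i) : ℝ) : ℂ)) * τ p * ft f p.1 *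
          ft g p.2 = ∑ μ ∈ S, ∑ ν ∈ S', F μ * G ν * (σf μ ν p *
        (chr x (p.1 + p.2) * (φ (p.1 - coeZ μ) * ψ (p.2 - coeZ ν)))) := by
      intro p
      rw [show cexp ((2 * Real.pi * I) * ((∑ i, x i * (p.1 i + p.2 i) : ℝ) : ℂ)) =
        chr x (p.1 + p.2) from rfl, hτ', Finset.mul_sum, Finset.sum_mul, Finset.sum_mul]
      refine Finset.sum_congr rfl fun μ hμ => ?_
      rw [Finset.mul_sum, Finset.sum_mul, Finset.sum_mul]
      refine Finset.sum_congr rfl fun ν hν => ?_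
      by_cases h0 : σf μ ν p = 0
      · simp [h0]
      · obtain ⟨h1, h2⟩ := h.supp μ ν p h0
        rw [hf, hg, hS.sum_eq hφ F hμ ((norm_le_of_mem_cube hK h1).trans hR),
          hS'.sum_eq hψ G hν ((norm_le_of_mem_cube hK h2).trans hR)]
        ring
    simp_rw [e1]
    rw [integral_finsetSum _ fun μ _ => integrable_finsetSum _ fun ν _ => hFG μ ν]
    exact Finset.sum_congr rfl fun μ _ => integral_finsetSum _ fun ν _ => hFG μ ν
  rw [← funext hT]
  refine (localL2_Tbil_le τ f g ρ).trans ?_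
  rw [mul_assoc]
  refine mul_le_mul' hM ?_
  calc eLpNorm f 2 volume * eLpNorm g 2 volume
      ≤ (volume (Metric.closedBall (0 : Rn n) R) ^ (1 / 2 : ℝ) * ell2 S F) *
        (volume (Metric.closedBall (0 : Rn n) R) ^ (1 / 2 : ℝ) * ell2 S' G) := by gcongr
    _ = (volume (Metric.closedBall (0 : Rn n) R) ^ (1 / 2 : ℝ)) ^ 2 * (ell2 S F * ell2 S' G) := by
        ring
    _ = _ := by rw [ennreal_sqrt_sq]

end LocalizedFamily

theorem localL2_eq_eLpNorm {n : ℕ} (h : Rn n → ℂ) (ρ : Zn n) :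
    localL2 h ρ = eLpNorm (fun t => h (t + coeZ ρ)) 2 (volume.restrict (cube n 1)) := by
  rw [← ENNReal.pow_right_strictMono two_ne_zero |>.injective.eq_iff, localL2_sq, eLpNorm_two_sq]

theorem measurableSet_cube (n : ℕ) (a : ℝ) : MeasurableSet (cube n a) :=
  MeasurableSet.univ_pi fun _ => measurableSet_Icc

/-- The bilinear trigonometric sum with coefficient matrix `B`. -/
noncomputable def trigForm {n : ℕ} (B : Zn n → Zn n → ℂ) (S S' : Finset (Zn n)) (F G : Zn n → ℂ)
    (x : Rn n) : ℂ :=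
  ∑ μ ∈ S, ∑ ν ∈ S', F μ * G ν * (B μ ν * chr x (coeZ μ + coeZ ν))

theorem continuous_trigForm {n : ℕ} (B : Zn n → Zn n → ℂ) (S S' : Finset (Zn n))
    (F G : Zn n → ℂ) : Continuous (trigForm B S S' F G) := by
  unfold trigForm
  have : ∀ ξ : Rn n, Continuous fun x => chr x ξ := fun ξ =>
    continuous_chr.comp (Continuous.prodMk_left ξ)
  fun_prop

theorem exists_cutoff (n : ℕ) {K : ℝ} (hK : 0 < K) : ∃ χ : Rn n → ℂ, ContDiff ℝ (⊤ : ℕ∞) χ ∧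
    (∀ ζ, χ ζ ≠ 0 → ‖ζ‖ ≤ K + 1) ∧ (∀ ζ, ‖χ ζ‖ ≤ 1) ∧ ∀ ζ, ‖ζ‖ ≤ K → χ ζ = 1 := by
  let b : ContDiffBump (0 : Rn n) := ⟨K, K + 1, hK, by linarith⟩
  refine ⟨fun ζ => (b ζ : ℂ), ofRealCLM.contDiff.comp b.contDiff, ?_, ?_, ?_⟩
  · intro ζ hζ
    have : ζ ∈ Function.support b := fun h => hζ (by simp [h])
    rw [b.support_eq, mem_ball_zero_iff] at this
    exact this.le
  · intro ζ
    rw [Complex.norm_real, Real.norm_of_nonneg b.nonneg]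
    exact b.le_one
  · intro ζ hζ
    beta_reduce
    rw [b.one_of_mem_closedBall (mem_closedBall_zero_iff.2 hζ)]
    simp

namespace LocalizedFamily

variable {n : ℕ} {K C : ℝ} {M : ℝ≥0} {σf : Zn n → Zn n → Rn n × Rn n → ℂ}

theorem integrable_testForm (h : LocalizedFamily K C M σf) (hK : 0 < K) (x : Rn n) (μ ν : Zn n)
    {φ ψ : Rn n → ℂ} (hφ : Continuous φ) (hψ : Continuous ψ) {D : ℝ} (hφ1 : ∀ ζ, ‖φ ζ‖ ≤ D)
    (hψ1 : ∀ ζ, ‖ψ ζ‖ ≤ D) :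
    Integrable fun p : Rn n × Rn n => σf μ ν p *
      (chr x (p.1 + p.2) * (φ (p.1 - coeZ μ) * ψ (p.2 - coeZ ν))) := by
  refine h.integrable_mul hK μ ν (D := D * D) ?_ ?_
  · have h3 : Continuous fun p : Rn n × Rn n => chr x (p.1 + p.2) :=
      (contDiff_chr x).continuous.comp (by fun_prop)
    fun_prop
  · intro p
    rw [norm_mul, norm_mul, norm_chr, one_mul]
    exact mul_le_mul (hφ1 _) (hψ1 _) (norm_nonneg _) ((norm_nonneg _).trans (hφ1 0))

theorem continuous_testForm (h : LocalizedFamily K C M σf) (hK : 0 < K) (S S' : Finset (Zn n))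
    (F G : Zn n → ℂ) {φ ψ : Rn n → ℂ} (hφ : Continuous φ) (hψ : Continuous ψ)
    (hφ1 : ∀ ζ, ‖φ ζ‖ ≤ 1) (hψ1 : ∀ ζ, ‖ψ ζ‖ ≤ 1) :
    Continuous (testForm σf S S' F G φ ψ) := by
  unfold testForm
  refine continuous_finsetSum _ fun μ _ => continuous_finsetSum _ fun ν _ =>
    continuous_const.mul ?_
  refine continuous_of_dominated (bound := fun p => ‖σf μ ν p‖)
    (fun x => (h.integrable_testForm hK x μ ν hφ hψ hφ1 hψ1).aestronglyMeasurable) ?_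
    (h.integrable hK μ ν).norm ?_
  · refine fun x => Filter.Eventually.of_forall fun p => ?_
    rw [norm_mul, norm_mul, norm_chr, one_mul, norm_mul]
    exact mul_le_of_le_one_right (norm_nonneg _) (mul_le_one₀ (hφ1 _) (norm_nonneg _) (hψ1 _))
  · refine Filter.Eventually.of_forall fun p => ?_
    have : Continuous fun x => chr x (p.1 + p.2) :=
      continuous_chr.comp (Continuous.prodMk_left _)
    fun_prop

theorem testForm_sum_sum (h : LocalizedFamily K C M σf) (hK : 0 < K) (S S' : Finset (Zn n))
    (F G : Zn n → ℂ) {ι : Type*} [Fintype ι] (c : ι → ℂ) {φ : ι → Rn n → ℂ}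
    (hφ : ∀ j, Continuous (φ j)) (hφ1 : ∀ j ζ, ‖φ j ζ‖ ≤ 1) (x : Rn n) :
    testForm σf S S' F G (fun ζ => ∑ j, c j * φ j ζ) (fun ζ => ∑ j, c j * φ j ζ) x =
      ∑ J : ι × ι, c J.1 * c J.2 * testForm σf S S' F G (φ J.1) (φ J.2) x := by
  have key : ∀ μ ν, ∫ p : Rn n × Rn n, σf μ ν p * (chr x (p.1 + p.2) *
      ((∑ j, c j * φ j (p.1 - coeZ μ)) * ∑ j, c j * φ j (p.2 - coeZ ν))) =
      ∑ J : ι × ι, c J.1 * c J.2 * ∫ p : Rn n × Rn n, σf μ ν p * (chr x (p.1 + p.2) *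
        (φ J.1 (p.1 - coeZ μ) * φ J.2 (p.2 - coeZ ν))) := by
    intro μ ν
    simp_rw [← integral_const_mul]
    rw [← integral_finsetSum _ fun J _ =>
      (h.integrable_testForm hK x μ ν (hφ J.1) (hφ J.2) (hφ1 J.1) (hφ1 J.2)).const_mul _]
    congr 1
    ext p
    rw [Fintype.sum_prod_type, Finset.sum_mul_sum, Finset.mul_sum, Finset.mul_sum]
    refine Finset.sum_congr rfl fun i _ => ?_
    rw [Finset.mul_sum, Finset.mul_sum]
    refine Finset.sum_congr rfl fun j _ => ?_
    ring
  unfold testForm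
  simp_rw [key, Finset.mul_sum]
  rw [Finset.sum_comm]
  conv_rhs => rw [Finset.sum_comm]
  rw [Finset.sum_comm]
  refine Finset.sum_congr rfl fun μ _ => ?_
  conv_rhs => rw [Finset.sum_comm]
  refine Finset.sum_congr rfl fun ν _ => Finset.sum_congr rfl fun J _ => ?_
  ring

theorem tendsto_testForm (h : LocalizedFamily K C M σf) (hK : 0 < K) (S S' : Finset (Zn n))
    (F G : Zn n → ℂ) {χ : Rn n → ℂ} (hχs : ContDiff ℝ (⊤ : ℕ∞) χ)
    (hχ : ∀ ζ, χ ζ ≠ 0 → ‖ζ‖ ≤ K + 1) (hχ1 : ∀ ζ, ‖χ ζ‖ ≤ 1) (hχK : ∀ ζ, ‖ζ‖ ≤ K → χ ζ = 1)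
    (t r : Rn n) :
    Filter.Tendsto (fun k => testForm σf S S' F G
      (fun ζ => expTaylor k t ζ * (chr (-r) ζ * χ ζ))
      (fun ζ => expTaylor k t ζ * (chr (-r) ζ * χ ζ)) (t + r)) Filter.atTop
      (nhds (trigForm (fun μ ν => ∫ p, σf μ ν p) S S' F G (t + r))) := by
  unfold testForm trigForm
  refine tendsto_finsetSum _ fun μ _ => tendsto_finsetSum _ fun ν _ =>
    Filter.Tendsto.const_mul _ ?_
  set D : ℝ := Real.exp (2 * Real.pi * (n * (‖t‖ * (K + 1)))) with hD
  have hb : ∀ k ζ, ‖expTaylor k t ζ * (chr (-r) ζ * χ ζ)‖ ≤ D := by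
    intro k ζ
    by_cases h0 : χ ζ = 0
    · rw [h0]; simp [hD, Real.exp_nonneg]
    rw [norm_mul, norm_mul, norm_chr, one_mul]
    refine (mul_le_of_le_one_right (norm_nonneg _) (hχ1 ζ)).trans
      ((norm_expTaylor_le k t ζ).trans ?_)
    rw [hD]
    gcongr
    refine (Finset.abs_sum_le_sum_abs _ _).trans ?_
    refine (Finset.sum_le_card_nsmul _ _ (‖t‖ * (K + 1)) ?_).trans (by simp)
    intro i _
    rw [abs_mul]
    exact mul_le_mul (norm_le_pi_norm t i) ((norm_le_pi_norm ζ i).trans (hχ ζ h0))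
      (abs_nonneg _) (norm_nonneg _)
  have hc : ∀ k, Continuous fun ζ => expTaylor k t ζ * (chr (-r) ζ * χ ζ) := by
    intro k
    have h1 := continuous_expTaylor k t
    have h2 := (contDiff_chr (-r)).continuous
    have h3 := hχs.continuous
    fun_prop
  rw [← integral_mul_const]
  refine tendsto_integral_of_dominated_convergence (fun p => ‖σf μ ν p‖ * (D * D))
    (fun k => (h.integrable_testForm hK _ μ ν (hc k) (hc k) (hb k) (hb k)).aestronglyMeasurable)
    ((h.integrable hK μ ν).norm.mul_const _) ?_ ?_
  · refine fun k => Filter.Eventually.of_forall fun p => ?_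
    rw [norm_mul, norm_mul, norm_chr, one_mul, norm_mul]
    gcongr
    · exact hb _ _
    · exact hb _ _
  · refine Filter.Eventually.of_forall fun p => ?_
    by_cases h0 : σf μ ν p = 0
    · simp [h0]
    obtain ⟨h1, h2⟩ := h.supp μ ν p h0
    beta_reduce
    rw [hχK _ (norm_le_of_mem_cube hK h1), hχK _ (norm_le_of_mem_cube hK h2)]
    refine Filter.Tendsto.const_mul _ ?_
    have e : chr (t + r) (coeZ μ + coeZ ν) = chr (t + r) (p.1 + p.2) *
        (chr (-t) (p.1 - coeZ μ) * (chr (-r) (p.1 - coeZ μ) * 1) *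
        (chr (-t) (p.2 - coeZ ν) * (chr (-r) (p.2 - coeZ ν) * 1))) := by
      have e1 : p.1 + p.2 = (coeZ μ + coeZ ν) + ((p.1 - coeZ μ) + (p.2 - coeZ ν)) := by abel
      rw [e1, chr_add_right (t + r) (coeZ μ + coeZ ν), chr_add_right _ (p.1 - coeZ μ)]
      have e2 := chr_neg_mul_self (t + r) (p.1 - coeZ μ)
      have e3 := chr_neg_mul_self (t + r) (p.2 - coeZ ν)
      rw [neg_add, chr_add_left] at e2 e3
      linear_combination (-chr (t + r) (coeZ μ + coeZ ν)) * e2 -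
        chr (t + r) (coeZ μ + coeZ ν) * (chr (-t) (p.1 - coeZ μ) * chr (-r) (p.1 - coeZ μ)
          * chr (t + r) (p.1 - coeZ μ)) * e3
    rw [e]
    exact (((tendsto_expTaylor t _).mul_const _).mul
      ((tendsto_expTaylor t _).mul_const _)).const_mul _

theorem localL2_trigForm_le_of_latSep (h : LocalizedFamily K C M σf) (hK : 0 < K)
    {S S' : Finset (Zn n)} (hS : LatSep (K + 1) S) (hS' : LatSep (K + 1) S')
    (F G : Zn n → ℂ) (ρ : Zn n) :
    localL2 (trigForm (fun μ ν => ∫ p, σf μ ν p) S S' F G) ρ ≤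
      ENNReal.ofReal (Real.exp (2 * Real.pi * (K + 1) * n)) ^ 2 *
        (M * volume (Metric.closedBall (0 : Rn n) (K + 1)) * (ell2 S F * ell2 S' G)) := by
  obtain ⟨χ, hχs, hχ, hχ1, hχK⟩ := exists_cutoff n hK
  have hR : 0 < K + 1 := by linarith
  set Y : ℝ≥0∞ := M * volume (Metric.closedBall (0 : Rn n) (K + 1)) * (ell2 S F * ell2 S' G)
  set φ : (k : ℕ) → ((j : Fin k) × (Fin j → Fin n)) → Rn n → ℂ := fun k J ζ =>
    scaledMonomial (K + 1) J.2 ζ * (chr (-coeZ ρ) ζ * χ ζ) with hφdef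
  have hφs : ∀ k J, ContDiff ℝ (⊤ : ℕ∞) (φ k J) := fun k J =>
    (contDiff_scaledMonomial _ _).mul ((contDiff_chr _).mul hχs)
  have hφ : ∀ k J ζ, φ k J ζ ≠ 0 → ‖ζ‖ ≤ K + 1 := fun k J ζ hne =>
    hχ ζ (right_ne_zero_of_mul (right_ne_zero_of_mul hne))
  have hφ1 : ∀ k J ζ, ‖φ k J ζ‖ ≤ 1 := by
    intro k J ζ
    by_cases h0 : φ k J ζ = 0
    · simp [h0]
    rw [hφdef]
    simp only
    rw [norm_mul, norm_mul, norm_chr, one_mul]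
    exact mul_le_one₀ (norm_scaledMonomial_le hR _ (hφ k J ζ h0)) (norm_nonneg _) (hχ1 ζ)
  set U : (k : ℕ) → (((j : Fin k) × (Fin j → Fin n)) × ((j : Fin k) × (Fin j → Fin n))) →
      Rn n → ℂ := fun k J t => testForm σf S S' F G (φ k J.1) (φ k J.2) (t + coeZ ρ) with hU
  have hUc : ∀ k J, Continuous (U k J) := fun k J =>
    (h.continuous_testForm hK S S' F G (hφs k J.1).continuous (hφs k J.2).continuous
      (hφ1 k J.1) (hφ1 k J.2)).comp (continuous_add_const _)
  have hUn : ∀ k J, eLpNorm (U k J) 2 (volume.restrict (cube n 1)) ≤ Y := by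
    intro k J
    have := h.localL2_testForm_le hK (by linarith : K ≤ K + 1) hS hS' (hφs k J.1) (hφ k J.1)
      (hφ1 k J.1) (hφs k J.2) (hφ k J.2) (hφ1 k J.2) F G ρ
    rwa [localL2_eq_eLpNorm] at this
  set W : ℕ → Rn n → ℂ := fun k => ∑ J, fun t =>
    taylorCoeff (K + 1) J.1.2 t * taylorCoeff (K + 1) J.2.2 t * U k J t with hW
  have hWm : ∀ k J, Continuous fun t =>
      taylorCoeff (K + 1) J.1.2 t * taylorCoeff (K + 1) J.2.2 t * U k J t := fun k J =>
    ((continuous_taylorCoeff _ _).mul (continuous_taylorCoeff _ _)).mul (hUc k J)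
  have hWlim : ∀ t, Filter.Tendsto (fun k => W k t) Filter.atTop
      (nhds (trigForm (fun μ ν => ∫ p, σf μ ν p) S S' F G (t + coeZ ρ))) := by
    intro t
    refine (h.tendsto_testForm hK S S' F G hχs hχ hχ1 hχK t (coeZ ρ)).congr fun k => ?_
    have e : (fun ζ => expTaylor k t ζ * (chr (-coeZ ρ) ζ * χ ζ)) =
        fun ζ => ∑ J : (j : Fin k) × (Fin j → Fin n),
          taylorCoeff (K + 1) J.2 t * φ k J ζ := by
      ext ζ
      rw [expTaylor_eq_sum hR, Finset.sum_mul]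
      exact Finset.sum_congr rfl fun J _ => mul_assoc _ _ _
    rw [e, h.testForm_sum_sum hK S S' F G _ (fun J => (hφs k J).continuous) (hφ1 k)]
    simp only [hW, Finset.sum_apply, hU]
  have hWn : ∀ k, eLpNorm (W k) 2 (volume.restrict (cube n 1)) ≤
      ENNReal.ofReal (Real.exp (2 * Real.pi * (K + 1) * n)) ^ 2 * Y := by
    intro k
    set a : ((j : Fin k) × (Fin j → Fin n)) → ℝ := fun J =>
      (2 * Real.pi * (K + 1)) ^ (J.1 : ℕ) / ((J.1 : ℕ).factorial : ℝ) with ha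
    have ha0 : ∀ J, 0 ≤ a J := fun J => by positivity
    calc eLpNorm (W k) 2 (volume.restrict (cube n 1))
        ≤ ∑ J, eLpNorm (fun t => taylorCoeff (K + 1) J.1.2 t * taylorCoeff (K + 1) J.2.2 t *
            U k J t) 2 (volume.restrict (cube n 1)) :=
          eLpNorm_sum_le (fun J _ => (hWm k J).aestronglyMeasurable) (by norm_num)
      _ ≤ ∑ J : _ × _, ENNReal.ofReal (a J.1 * a J.2) * Y := by
          refine Finset.sum_le_sum fun J _ => ?_
          refine (eLpNorm_le_mul_eLpNorm_of_ae_le_mul (g := U k J) (c := a J.1 * a J.2) ?_ 2).trans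
            (mul_le_mul_right (hUn k J) _)
          refine (ae_restrict_mem (measurableSet_cube n 1)).mono fun t ht => ?_
          rw [norm_mul, norm_mul]
          gcongr
          · exact norm_taylorCoeff_le hR _ ht
          · exact norm_taylorCoeff_le hR _ ht
      _ = ENNReal.ofReal ((∑ J, a J) ^ 2) * Y := by
          rw [← Finset.sum_mul, ← ENNReal.ofReal_sum_of_nonneg
            fun J _ => mul_nonneg (ha0 _) (ha0 _), sq, Finset.sum_mul_sum, Fintype.sum_prod_type]
      _ ≤ _ := by
          rw [← ENNReal.ofReal_pow (Real.exp_nonneg _)]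
          gcongr
          exact sum_taylorCoeff_bound_le hR k
  rw [localL2_eq_eLpNorm]
  refine (Lp.eLpNorm_lim_le_liminf_eLpNorm (f := W) (fun k => ?_) _
    (Filter.Eventually.of_forall hWlim)).trans ?_
  · exact (Finset.aestronglyMeasurable_sum _ fun J _ => (hWm k J).aestronglyMeasurable)
  · exact Filter.liminf_le_of_frequently_le' (Filter.Frequently.of_forall hWn)

end LocalizedFamily

theorem ell2_mono {ι : Type*} {S S' : Finset ι} (h : S ⊆ S') (F : ι → ℂ) :
    ell2 S F ≤ ell2 S' F := by
  unfold ell2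
  gcongr

/-- Residue class of a lattice point modulo `N`. -/
def residue {n : ℕ} (N : ℕ) (μ : Zn n) : Fin n → ZMod N := fun i => (μ i : ZMod N)

open Classical in
theorem latSep_filter_residue {n : ℕ} {R : ℝ} {N : ℕ} (hN : 2 * R < N) (S : Finset (Zn n))
    (r : Fin n → ZMod N) : LatSep R (S.filter fun μ => residue N μ = r) := by
  intro μ hμ ν hν hne
  rw [Finset.mem_filter] at hμ hν
  obtain ⟨i, hi⟩ := Function.ne_iff.1 hne
  have h1 : ((μ i : ℤ) : ZMod N) = (ν i : ZMod N) :=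
    congrFun (hμ.2.trans hν.2.symm) i
  rw [ZMod.intCast_eq_intCast_iff_dvd_sub] at h1
  have h2 : (N : ℤ) ≤ |ν i - μ i| := by
    have := Int.le_of_dvd (abs_pos.2 (sub_ne_zero.2 (Ne.symm hi))) ((dvd_abs _ _).2 h1)
    exact this
  have h3 : (N : ℝ) ≤ |(ν i : ℝ) - μ i| := by exact_mod_cast h2
  have h4 := norm_le_pi_norm (coeZ μ - coeZ ν) i
  simp only [Pi.sub_apply, coeZ, Real.norm_eq_abs] at h4
  rw [abs_sub_comm] at h3
  exact hN.trans_le (h3.trans h4)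

open Classical in
theorem trigForm_eq_sum_residue {n : ℕ} (N : ℕ) [NeZero N] (B : Zn n → Zn n → ℂ)
    (S S' : Finset (Zn n)) (F G : Zn n → ℂ) :
    trigForm B S S' F G = ∑ r : (Fin n → ZMod N) × (Fin n → ZMod N),
      trigForm B (S.filter fun μ => residue N μ = r.1) (S'.filter fun μ => residue N μ = r.2)
        F G := by
  ext x
  rw [Finset.sum_apply, Fintype.sum_prod_type]
  unfold trigForm
  refine (Finset.sum_fiberwise S (residue N) _).symm.trans ?_
  refine Finset.sum_congr rfl fun r _ => ?_
  refine Eq.trans ?_ (Finset.sum_comm (s := S.filter fun μ => residue N μ = r)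
    (t := Finset.univ) (f := fun μ s => ∑ ν ∈ S'.filter (fun ν => residue N ν = s),
      F μ * G ν * (B μ ν * chr x (coeZ μ + coeZ ν))))
  refine Finset.sum_congr rfl fun μ _ => ?_
  exact (Finset.sum_fiberwise S' (residue N) _).symm

open Classical in
theorem exists_trigForm_bound (n : ℕ) {K : ℝ} (hK : 0 < K) : ∃ c : ℝ≥0∞, c < ∞ ∧
    ∀ {C : ℝ} {M : ℝ≥0} {σf : Zn n → Zn n → Rn n × Rn n → ℂ}, LocalizedFamily K C M σf →
      ∀ (S S' : Finset (Zn n)) (F G : Zn n → ℂ) (ρ : Zn n),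
        localL2 (trigForm (fun μ ν => ∫ p, σf μ ν p) S S' F G) ρ ≤
          c * M * (ell2 S F * ell2 S' G) := by
  obtain ⟨N, hN⟩ := exists_nat_gt (2 * (K + 1))
  have : NeZero N := ⟨by rintro rfl; norm_num at hN; linarith⟩
  refine ⟨Fintype.card ((Fin n → ZMod N) × (Fin n → ZMod N)) *
    (ENNReal.ofReal (Real.exp (2 * Real.pi * (K + 1) * n)) ^ 2 *
      volume (Metric.closedBall (0 : Rn n) (K + 1))), ?_, ?_⟩
  · have : volume (Metric.closedBall (0 : Rn n) (K + 1)) ≠ ∞ := measure_closedBall_lt_top.ne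
    finiteness
  intro C M σf h S S' F G ρ
  rw [localL2_eq_eLpNorm, trigForm_eq_sum_residue N]
  have e : (fun t => (∑ r : (Fin n → ZMod N) × (Fin n → ZMod N),
      trigForm (fun μ ν => ∫ p, σf μ ν p) (S.filter fun μ => residue N μ = r.1)
        (S'.filter fun μ => residue N μ = r.2) F G) (t + coeZ ρ)) =
      ∑ r : (Fin n → ZMod N) × (Fin n → ZMod N), fun t =>
      trigForm (fun μ ν => ∫ p, σf μ ν p) (S.filter fun μ => residue N μ = r.1)
        (S'.filter fun μ => residue N μ = r.2) F G (t + coeZ ρ) := by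
    ext t
    simp only [Finset.sum_apply]
  rw [e]
  refine (eLpNorm_sum_le (fun r _ => ((continuous_trigForm _ _ _ _ _).comp
    (continuous_add_const _)).aestronglyMeasurable) (by norm_num)).trans ?_
  refine (Finset.sum_le_card_nsmul _ _
    (ENNReal.ofReal (Real.exp (2 * Real.pi * (K + 1) * n)) ^ 2 *
        (M * volume (Metric.closedBall (0 : Rn n) (K + 1)) * (ell2 S F * ell2 S' G))) ?_).trans
    (le_of_eq ?_)
  · intro r _
    have h1 := h.localL2_trigForm_le_of_latSep hK (latSep_filter_residue hN S r.1)
      (latSep_filter_residue hN S' r.2) F G ρ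
    rw [localL2_eq_eLpNorm] at h1
    refine h1.trans ?_
    gcongr
    · exact ell2_mono (Finset.filter_subset _ _) F
    · exact ell2_mono (Finset.filter_subset _ _) G
  · rw [nsmul_eq_mul, Finset.card_univ]
    ring

theorem sq_lintegral_le {α : Type*} [MeasurableSpace α] (μ : Measure α) {h : α → ℝ≥0∞}
    (hh : AEMeasurable h μ) : (∫⁻ x, h x ∂μ) ^ 2 ≤ μ Set.univ * ∫⁻ x, h x ^ 2 ∂μ := by
  have := ENNReal.lintegral_mul_le_Lp_mul_Lq μ Real.HolderConjugate.two_two hh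
    (aemeasurable_const (b := 1))
  simp only [Pi.mul_apply, mul_one, ENNReal.one_rpow, lintegral_const, one_mul] at this
  calc (∫⁻ x, h x ∂μ) ^ 2 ≤ _ := pow_le_pow_left' this 2
    _ = _ := by
      rw [mul_pow, ennreal_sqrt_sq, ennreal_sqrt_sq, mul_comm]
      simp

theorem setLIntegral_sum_translates_le {n : ℕ} {R : ℝ} {N : ℕ}
    (hN : ∀ (x : Rn n) (S : Finset (Zn n)), (∀ μ ∈ S, ‖x - coeZ μ‖ ≤ R) → S.card ≤ N)
    (S : Finset (Zn n)) {u : Rn n → ℝ≥0∞} (hu : Measurable u) :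
    ∫⁻ ξ in Metric.closedBall (0 : Rn n) R, ∑ μ ∈ S, u (ξ + coeZ μ) ≤ N * ∫⁻ ξ, u ξ := by
  classical
  have hm : MeasurableSet (Metric.closedBall (0 : Rn n) R) := measurableSet_closedBall
  calc ∫⁻ ξ in Metric.closedBall (0 : Rn n) R, ∑ μ ∈ S, u (ξ + coeZ μ)
      = ∑ μ ∈ S, ∫⁻ ξ in Metric.closedBall (0 : Rn n) R, u (ξ + coeZ μ) :=
        lintegral_finsetSum _ fun μ _ => hu.comp (measurable_add_const _)
    _ = ∑ μ ∈ S, ∫⁻ ξ, (if ‖ξ - coeZ μ‖ ≤ R then 1 else 0) * u ξ := by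
        refine Finset.sum_congr rfl fun μ _ => ?_
        rw [← lintegral_indicator hm, ← lintegral_add_right_eq_self
          (fun ξ => (if ‖ξ - coeZ μ‖ ≤ R then 1 else 0) * u ξ) (coeZ μ)]
        refine lintegral_congr fun ξ => ?_
        rw [Set.indicator_apply]
        simp
    _ = ∫⁻ ξ, ∑ μ ∈ S, (if ‖ξ - coeZ μ‖ ≤ R then 1 else 0) * u ξ := by
        refine (lintegral_finsetSum _ fun μ _ => Measurable.mul ?_ hu).symm
        exact Measurable.ite (measurableSet_le (by fun_prop) measurable_const)
          measurable_const measurable_const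
    _ ≤ ∫⁻ ξ, N * u ξ := by
        refine lintegral_mono fun ξ => ?_
        rw [← Finset.sum_mul, Finset.sum_boole]
        gcongr
        exact_mod_cast hN ξ _ fun μ hμ => (Finset.mem_filter.1 hμ).2
    _ = N * ∫⁻ ξ, u ξ := lintegral_const_mul _ hu

/-- The truncation of `sigmaA` to a finite set of lattice points. -/
noncomputable def sigmaTrunc {n : ℕ} (B : Zn n → Zn n → ℂ) (Φ : Rn n × Rn n → ℂ)
    (S : Finset (Zn n)) (p : Rn n × Rn n) : ℂ :=
  ∑ μ ∈ S, ∑ ν ∈ S, B μ ν * Φ (p.1 - coeZ μ, p.2 - coeZ ν)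

theorem continuous_sigmaTrunc {n : ℕ} (B : Zn n → Zn n → ℂ) {Φ : Rn n × Rn n → ℂ}
    (hΦ : Continuous Φ) (S : Finset (Zn n)) : Continuous (sigmaTrunc B Φ S) := by
  unfold sigmaTrunc
  fun_prop

open Classical in
theorem norm_sigmaTrunc_le {n : ℕ} {B : Zn n → Zn n → ℂ} {b : ℝ} (hB : ∀ μ ν, ‖B μ ν‖ ≤ b)
    {Φ : Rn n × Rn n → ℂ} {D R : ℝ} (hD : ∀ p, ‖Φ p‖ ≤ D)
    (hR : ∀ p, Φ p ≠ 0 → ‖p.1‖ ≤ R ∧ ‖p.2‖ ≤ R) {N : ℕ}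
    (hN : ∀ (x : Rn n) (S : Finset (Zn n)), (∀ μ ∈ S, ‖x - coeZ μ‖ ≤ R) → S.card ≤ N)
    (S : Finset (Zn n)) (p : Rn n × Rn n) : ‖sigmaTrunc B Φ S p‖ ≤ N * (N * (b * D)) := by
  have hb : 0 ≤ b := (norm_nonneg _).trans (hB 0 0)
  have hD0 : 0 ≤ D := (norm_nonneg _).trans (hD 0)
  have e : sigmaTrunc B Φ S p = ∑ μ ∈ S.filter (fun μ => ‖p.1 - coeZ μ‖ ≤ R),
      ∑ ν ∈ S.filter (fun ν => ‖p.2 - coeZ ν‖ ≤ R),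
        B μ ν * Φ (p.1 - coeZ μ, p.2 - coeZ ν) := by
    unfold sigmaTrunc
    rw [Finset.sum_filter_of_ne]
    · refine Finset.sum_congr rfl fun μ _ => ?_
      rw [Finset.sum_filter_of_ne]
      exact fun ν _ hne => (hR _ (right_ne_zero_of_mul hne)).2
    · intro μ _ hne
      obtain ⟨ν, _, hne⟩ := Finset.exists_ne_zero_of_sum_ne_zero hne
      exact (hR _ (right_ne_zero_of_mul hne)).1
  have h1 : ∀ (x : Rn n), ((S.filter (fun μ => ‖x - coeZ μ‖ ≤ R)).card : ℝ) ≤ N := fun x => by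
    exact_mod_cast hN x _ fun μ hμ => (Finset.mem_filter.1 hμ).2
  rw [e]
  refine (norm_sum_le_of_le (f := fun μ => ∑ ν ∈ S.filter (fun ν => ‖p.2 - coeZ ν‖ ≤ R),
        B μ ν * Φ (p.1 - coeZ μ, p.2 - coeZ ν)) _ (n := fun _ => N * (b * D)) fun μ _ => ?_).trans ?_
  · refine (norm_sum_le_of_le _ (n := fun _ => b * D) fun ν _ => ?_).trans ?_
    · rw [norm_mul]
      exact mul_le_mul (hB _ _) (hD _) (norm_nonneg _) hb
    · rw [Finset.sum_const, nsmul_eq_mul]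
      exact mul_le_mul_of_nonneg_right (h1 _) (by positivity)
  · rw [Finset.sum_const, nsmul_eq_mul]
    exact mul_le_mul_of_nonneg_right (h1 _) (by positivity)

instance {n : ℕ} : (volume : Measure (Rn n × Rn n)).IsAddHaarMeasure :=
  Measure.prod.instIsAddHaarMeasure _ _

theorem integrable_ft {n : ℕ} (f : SchwartzMap (Rn n) ℂ) : Integrable (ft f) := by
  rw [← coe_ftSchwartz]
  exact (ftSchwartz f).integrable

theorem continuous_ft {n : ℕ} (f : SchwartzMap (Rn n) ℂ) : Continuous (ft f) := by
  rw [← coe_ftSchwartz]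
  exact (ftSchwartz f).continuous

theorem integrable_Tbil {n : ℕ} {σ : Rn n × Rn n → ℂ} (hσ : Continuous σ) {D : ℝ}
    (hD : ∀ p, ‖σ p‖ ≤ D) (f g : SchwartzMap (Rn n) ℂ) (x : Rn n) :
    Integrable fun p : Rn n × Rn n => chr x (p.1 + p.2) * σ p * ft f p.1 * ft g p.2 := by
  have h1 : Integrable fun p : Rn n × Rn n => ft f p.1 * ft g p.2 :=
    (integrable_ft f).mul_prod (integrable_ft g)
  have h3 : Continuous fun p : Rn n × Rn n => chr x (p.1 + p.2) :=
    (contDiff_chr x).continuous.comp (by fun_prop)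
  refine (h1.bdd_mul (c := D) (h3.mul hσ).aestronglyMeasurable
    (Filter.Eventually.of_forall fun p => ?_)).congr (Filter.Eventually.of_forall fun p => ?_)
  · rw [Pi.mul_apply, norm_mul, norm_chr, one_mul]
    exact hD p
  · simp only [Pi.mul_apply]
    ring

theorem continuous_Tbil {n : ℕ} {σ : Rn n × Rn n → ℂ} (hσ : Continuous σ) {D : ℝ}
    (hD : ∀ p, ‖σ p‖ ≤ D) (f g : SchwartzMap (Rn n) ℂ) : Continuous (Tbil σ f g) := by
  have h1 : Integrable fun p : Rn n × Rn n => ft f p.1 * ft g p.2 :=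
    (integrable_ft f).mul_prod (integrable_ft g)
  refine continuous_of_dominated (bound := fun p => D * ‖ft f p.1 * ft g p.2‖)
    (fun x => (integrable_Tbil hσ hD f g x).aestronglyMeasurable) ?_ (h1.norm.const_mul _) ?_
  · refine fun x => Filter.Eventually.of_forall fun p => ?_
    change ‖chr x (p.1 + p.2) * σ p * ft f p.1 * ft g p.2‖ ≤ _
    rw [mul_assoc, norm_mul, norm_mul, norm_chr, one_mul]
    gcongr
    exact hD p
  · refine Filter.Eventually.of_forall fun p => ?_
    change Continuous fun x => chr x (p.1 + p.2) * σ p * ft f p.1 * ft g p.2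
    have : Continuous fun x => chr x (p.1 + p.2) :=
      continuous_chr.comp (Continuous.prodMk_left _)
    fun_prop

theorem Tbil_sigmaTrunc {n : ℕ} (B : Zn n → Zn n → ℂ) {Φ : Rn n × Rn n → ℂ}
    (hΦ : Continuous Φ) {D : ℝ} (hD : ∀ p, ‖Φ p‖ ≤ D) (S : Finset (Zn n))
    (f g : SchwartzMap (Rn n) ℂ) (x : Rn n) :
    Tbil (sigmaTrunc B Φ S) f g x = ∫ q : Rn n × Rn n, Φ q * (chr x (q.1 + q.2) *
      trigForm B S S (fun μ => ft f (q.1 + coeZ μ)) (fun ν => ft g (q.2 + coeZ ν)) x) := by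
  set w : Zn n → Zn n → Rn n × Rn n → ℂ := fun μ ν p =>
    chr x (p.1 + p.2) * (B μ ν * Φ (p.1 - coeZ μ, p.2 - coeZ ν)) * ft f p.1 * ft g p.2 with hw
  have hwi : ∀ μ ν, Integrable (w μ ν) := by
    intro μ ν
    refine integrable_Tbil (σ := fun p => B μ ν * Φ (p.1 - coeZ μ, p.2 - coeZ ν))
      (D := ‖B μ ν‖ * D) (by fun_prop) (fun p => ?_) f g x
    rw [norm_mul]
    gcongr
    exact hD _
  have hwi' : ∀ μ ν, Integrable fun q => w μ ν (q + (coeZ μ, coeZ ν)) := fun μ ν =>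
    (hwi μ ν).comp_add_right _
  have e1 : Tbil (sigmaTrunc B Φ S) f g x = ∫ p, ∑ μ ∈ S, ∑ ν ∈ S, w μ ν p := by
    unfold Tbil
    congr 1
    ext p
    rw [show cexp ((2 * Real.pi * I) * ((∑ i, x i * (p.1 i + p.2 i) : ℝ) : ℂ)) =
        chr x (p.1 + p.2) from rfl, sigmaTrunc]
    simp only [Finset.mul_sum, Finset.sum_mul, hw]
  have e2 : ∀ q : Rn n × Rn n, Φ q * (chr x (q.1 + q.2) *
      trigForm B S S (fun μ => ft f (q.1 + coeZ μ)) (fun ν => ft g (q.2 + coeZ ν)) x) =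
      ∑ μ ∈ S, ∑ ν ∈ S, w μ ν (q + (coeZ μ, coeZ ν)) := by
    intro q
    unfold trigForm
    simp only [Finset.mul_sum, hw]
    refine Finset.sum_congr rfl fun μ _ => Finset.sum_congr rfl fun ν _ => ?_
    simp only [Prod.fst_add, Prod.snd_add, add_sub_cancel_right, Prod.mk.eta]
    rw [show q.1 + coeZ μ + (q.2 + coeZ ν) = q.1 + q.2 + (coeZ μ + coeZ ν) by abel,
      chr_add_right x (q.1 + q.2)]
    ring
  simp_rw [e1, e2]
  rw [integral_finsetSum _ fun μ _ => integrable_finsetSum _ fun ν _ => hwi μ ν,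
    integral_finsetSum _ fun μ _ => integrable_finsetSum _ fun ν _ => hwi' μ ν]
  refine Finset.sum_congr rfl fun μ _ => ?_
  rw [integral_finsetSum _ fun ν _ => hwi μ ν, integral_finsetSum _ fun ν _ => hwi' μ ν]
  exact Finset.sum_congr rfl fun ν _ => (integral_add_right_eq_self (w μ ν) _).symm

theorem enorm_Tbil_sigmaTrunc_sq_le {n : ℕ} (B : Zn n → Zn n → ℂ) {Φ : Rn n × Rn n → ℂ}
    (hΦ : Continuous Φ) {D : ℝ} {R : ℝ} (hD : ∀ p, ‖Φ p‖ ≤ D)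
    (hR : ∀ p, Φ p ≠ 0 → ‖p.1‖ ≤ R ∧ ‖p.2‖ ≤ R) (S : Finset (Zn n))
    (f g : SchwartzMap (Rn n) ℂ) (x : Rn n) :
    ‖Tbil (sigmaTrunc B Φ S) f g x‖ₑ ^ 2 ≤
      ENNReal.ofReal D ^ 2 * volume (Metric.closedBall (0 : Rn n) R) ^ 2 *
      ∫⁻ q in Metric.closedBall (0 : Rn n) R ×ˢ Metric.closedBall (0 : Rn n) R, ‖trigForm B S S
        (fun μ => ft f (q.1 + coeZ μ)) (fun ν => ft g (q.2 + coeZ ν)) x‖ₑ ^ 2 := by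
  set P : Set (Rn n × Rn n) := Metric.closedBall (0 : Rn n) R ×ˢ Metric.closedBall (0 : Rn n) R
    with hP
  have hPm : MeasurableSet P := measurableSet_closedBall.prod measurableSet_closedBall
  set V : Rn n × Rn n → ℂ := fun q => trigForm B S S
        (fun μ => ft f (q.1 + coeZ μ)) (fun ν => ft g (q.2 + coeZ ν)) x with hV
  have hVc : Continuous V := by
    have h1 := continuous_ft f
    have h2 := continuous_ft g
    rw [hV]
    unfold trigForm
    fun_prop
  have h1 : ‖Tbil (sigmaTrunc B Φ S) f g x‖ₑ ≤ ENNReal.ofReal D * ∫⁻ q in P, ‖V q‖ₑ := by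
    rw [Tbil_sigmaTrunc B hΦ hD]
    refine (enorm_integral_le_lintegral_enorm _).trans ?_
    rw [← lintegral_const_mul _ hVc.enorm.measurable, ← lintegral_indicator hPm]
    refine lintegral_mono fun q => ?_
    by_cases h0 : Φ q = 0
    · simp [h0]
    obtain ⟨h2, h3⟩ := hR q h0
    have hq : q ∈ P := ⟨mem_closedBall_zero_iff.2 h2, mem_closedBall_zero_iff.2 h3⟩
    rw [Set.indicator_of_mem hq, enorm_mul, enorm_mul, ← ofReal_norm (chr x _), norm_chr,
      ENNReal.ofReal_one, one_mul, ← ofReal_norm (Φ q)]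
    gcongr
    exact hD q
  calc _ ≤ (ENNReal.ofReal D * ∫⁻ q in P, ‖V q‖ₑ) ^ 2 := pow_le_pow_left' h1 2
    _ ≤ ENNReal.ofReal D ^ 2 * ((volume.restrict P) Set.univ * ∫⁻ q in P, ‖V q‖ₑ ^ 2) := by
        rw [mul_pow]
        gcongr
        exact sq_lintegral_le _ hVc.enorm.aemeasurable
    _ = _ := by
        rw [Measure.restrict_apply_univ, hP, Measure.volume_eq_prod, Measure.prod_prod]
        ring

theorem localL2_Tbil_sigmaTrunc_le {n : ℕ} {M : ℝ≥0} {B : Zn n → Zn n → ℂ} {c : ℝ≥0∞}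
    (hc : ∀ (S S' : Finset (Zn n)) (F G : Zn n → ℂ) (ρ : Zn n),
        localL2 (trigForm B S S' F G) ρ ≤ c * M * (ell2 S F * ell2 S' G))
    {Φ : Rn n × Rn n → ℂ} (hΦ : Continuous Φ) {D R : ℝ} (hD : ∀ p, ‖Φ p‖ ≤ D)
    (hR : ∀ p, Φ p ≠ 0 → ‖p.1‖ ≤ R ∧ ‖p.2‖ ≤ R) {N : ℕ}
    (hN : ∀ (x : Rn n) (S : Finset (Zn n)), (∀ μ ∈ S, ‖x - coeZ μ‖ ≤ R) → S.card ≤ N)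
    (S : Finset (Zn n)) (f g : SchwartzMap (Rn n) ℂ) (ρ : Zn n) :
    localL2 (Tbil (sigmaTrunc B Φ S) f g) ρ ≤
      ENNReal.ofReal D * volume (Metric.closedBall (0 : Rn n) R) * c * N * M *
        (eLpNorm f 2 volume * eLpNorm g 2 volume) := by
  set P : Set (Rn n × Rn n) := Metric.closedBall (0 : Rn n) R ×ˢ Metric.closedBall (0 : Rn n) R
    with hP
  set V : Rn n × Rn n → Rn n → ℂ := fun q x => trigForm B S S
        (fun μ => ft f (q.1 + coeZ μ)) (fun ν => ft g (q.2 + coeZ ν)) x with hV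
  set A : ℝ≥0∞ := ENNReal.ofReal D ^ 2 * volume (Metric.closedBall (0 : Rn n) R) ^ 2 with hA
  have hA' : A ≠ ∞ := by
    have : volume (Metric.closedBall (0 : Rn n) R) ≠ ∞ := measure_closedBall_lt_top.ne
    rw [hA]; finiteness
  have hf := continuous_ft f
  have hg := continuous_ft g
  have hVc : Continuous fun z : Rn n × (Rn n × Rn n) => V z.2 (z.1 + coeZ ρ) := by
    rw [hV]
    unfold trigForm
    have : ∀ ξ : Rn n, Continuous fun z : Rn n × (Rn n × Rn n) => chr (z.1 + coeZ ρ) ξ := fun ξ =>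
      continuous_chr.comp (f := fun z : Rn n × (Rn n × Rn n) => (z.1 + coeZ ρ, ξ)) (by fun_prop)
    fun_prop
  refine ennreal_le_of_sq_le ?_
  rw [localL2_sq]
  calc ∫⁻ x in cube n 1, ‖Tbil (sigmaTrunc B Φ S) f g (x + coeZ ρ)‖ₑ ^ 2
      ≤ ∫⁻ x in cube n 1, A * ∫⁻ q in P, ‖V q (x + coeZ ρ)‖ₑ ^ 2 :=
        lintegral_mono fun x => enorm_Tbil_sigmaTrunc_sq_le B hΦ hD hR S f g _
    _ = A * ∫⁻ q in P, ∫⁻ x in cube n 1, ‖V q (x + coeZ ρ)‖ₑ ^ 2 := by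
        rw [lintegral_const_mul' _ _ hA', lintegral_lintegral_swap]
        exact (hVc.enorm.measurable.pow_const 2).aemeasurable
    _ ≤ A * ∫⁻ q in P, (c * M) ^ 2 * ((∑ μ ∈ S, ‖ft f (q.1 + coeZ μ)‖ₑ ^ 2) *
          ∑ ν ∈ S, ‖ft g (q.2 + coeZ ν)‖ₑ ^ 2) := by
        gcongr with q
        rw [← localL2_sq, ← ell2_sq S fun μ => ft f (q.1 + coeZ μ),
          ← ell2_sq S fun μ => ft g (q.2 + coeZ μ), ← mul_pow, ← mul_pow]
        exact pow_le_pow_left' (hc S S _ _ ρ) 2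
    _ = A * ((c * M) ^ 2 *
          ((∫⁻ ξ in Metric.closedBall (0 : Rn n) R, ∑ μ ∈ S, ‖ft f (ξ + coeZ μ)‖ₑ ^ 2) *
          ∫⁻ η in Metric.closedBall (0 : Rn n) R, ∑ ν ∈ S, ‖ft g (η + coeZ ν)‖ₑ ^ 2)) := by
        have hm : ∀ {u : Rn n → ℂ}, Continuous u →
            Measurable fun ξ : Rn n => ∑ μ ∈ S, ‖u (ξ + coeZ μ)‖ₑ ^ 2 := fun hu =>
          Finset.measurable_sum _ fun μ _ =>
            (hu.comp (continuous_add_const _)).enorm.measurable.pow_const 2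
        rw [lintegral_const_mul, Measure.volume_eq_prod, hP, ← Measure.prod_restrict,
          lintegral_prod_mul (hm hf).aemeasurable (hm hg).aemeasurable]
        exact ((hm hf).comp measurable_fst).mul ((hm hg).comp measurable_snd)
    _ ≤ A * ((c * M) ^ 2 * ((N * ∫⁻ ξ, ‖ft f ξ‖ₑ ^ 2) * (N * ∫⁻ η, ‖ft g η‖ₑ ^ 2))) := by
        gcongr
        · exact setLIntegral_sum_translates_le hN S (hf.enorm.measurable.pow_const 2)
        · exact setLIntegral_sum_translates_le hN S (hg.enorm.measurable.pow_const 2)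
    _ = _ := by
        rw [lintegral_enorm_sq_ft, lintegral_enorm_sq_ft, ← eLpNorm_two_sq, ← eLpNorm_two_sq, hA]
        ring

theorem tendsto_sigmaTrunc {n : ℕ} (B : Zn n → Zn n → ℂ) {Φ : Rn n × Rn n → ℂ} {R : ℝ}
    (hR : ∀ p, Φ p ≠ 0 → ‖p.1‖ ≤ R ∧ ‖p.2‖ ≤ R) (p : Rn n × Rn n) :
    Filter.Tendsto (fun m : ℕ => sigmaTrunc B Φ
      (Fintype.piFinset fun _ => Finset.Icc (-(m : ℤ)) m) p) Filter.atTop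
      (nhds (sigmaA B Φ p)) := by
  obtain ⟨m₀, hm₀⟩ := exists_nat_gt (‖p‖ + R)
  refine tendsto_const_nhds.congr' ?_
  filter_upwards [Filter.eventually_ge_atTop m₀] with m hm
  have key : ∀ (x : Rn n) (μ : Zn n), ‖x‖ ≤ ‖p‖ → ‖x - coeZ μ‖ ≤ R →
      μ ∈ Fintype.piFinset fun _ => Finset.Icc (-(m : ℤ)) m := by
    intro x μ hx hμ
    rw [Fintype.mem_piFinset]
    intro i
    have h1 : |(μ i : ℝ)| ≤ m := by
      have h2 : ‖coeZ μ‖ ≤ ‖x‖ + ‖x - coeZ μ‖ := by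
        have := norm_sub_le x (x - coeZ μ)
        rwa [sub_sub_cancel] at this
      have h3 := norm_le_pi_norm (coeZ μ) i
      have h4 : (m₀ : ℝ) ≤ m := by exact_mod_cast hm
      simp only [coeZ, Real.norm_eq_abs] at h3
      linarith
    have h2 : |μ i| ≤ (m : ℤ) := by exact_mod_cast h1
    rw [Finset.mem_Icc]
    exact abs_le.1 h2
  unfold sigmaA sigmaTrunc
  rw [tsum_eq_sum (s := (Fintype.piFinset fun _ => Finset.Icc (-(m : ℤ)) m) ×ˢ
    (Fintype.piFinset fun _ => Finset.Icc (-(m : ℤ)) m)), Finset.sum_product]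
  intro z hz
  by_contra hne
  obtain ⟨h1, h2⟩ := hR _ (right_ne_zero_of_mul hne)
  exact hz (Finset.mem_product.2 ⟨key _ _ (norm_fst_le p) h1, key _ _ (norm_snd_le p) h2⟩)

theorem LocalizedFamily.exists_integral_bound {n : ℕ} {K C : ℝ} {M : ℝ≥0}
    {σf : Zn n → Zn n → Rn n × Rn n → ℂ} (h : LocalizedFamily K C M σf) (hK : 0 < K) :
    ∃ b : ℝ, ∀ μ ν, ‖∫ p, σf μ ν p‖ ≤ b := by
  refine ⟨C * volume.real (Metric.closedBall (0 : Rn n × Rn n) K), fun μ ν => ?_⟩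
  have hs : Function.support (σf μ ν) ⊆ Metric.closedBall (coeZ μ, coeZ ν) K := by
    intro p hp
    obtain ⟨h1, h2⟩ := h.supp μ ν p hp
    rw [← closedBall_prod_same]
    exact ⟨mem_closedBall_iff_norm.2 (norm_le_of_mem_cube hK h1),
      mem_closedBall_iff_norm.2 (norm_le_of_mem_cube hK h2)⟩
  rw [← setIntegral_eq_integral_of_forall_compl_eq_zero (s := Metric.closedBall (coeZ μ, coeZ ν) K)
    fun p hp => Function.notMem_support.1 fun hp' => hp (hs hp')]
  refine (norm_setIntegral_le_of_norm_le_const measure_closedBall_lt_top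
    fun p _ => h.bound μ ν p).trans (le_of_eq ?_)
  rw [measureReal_def, measureReal_def, Measure.addHaar_closedBall_center]

/-- Lemma: from unconditional bounds to averages. -/
theorem statement5 (n : ℕ) (K : ℝ) (hK : 0 < K) (Φ : Rn n × Rn n → ℂ) (hΦ : IsCcInfty Φ) :
    ∃ c : ℝ≥0∞, c < ∞ ∧
      ∀ (σf : Zn n → Zn n → Rn n × Rn n → ℂ) (M : ℝ≥0),
        (∀ μ ν, Measurable (σf μ ν)) →
        (∃ C : ℝ, ∀ μ ν p, ‖σf μ ν p‖ ≤ C) →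
        (∀ μ ν, ∀ p : Rn n × Rn n, σf μ ν p ≠ 0 →
            p.1 - coeZ μ ∈ cube n K ∧ p.2 - coeZ ν ∈ cube n K) →
        (∀ α α' : Zn n → ℂ, (∀ μ, α μ = 0 ∨ α μ = 1) → (∀ ν, α' ν = 0 ∨ α' ν = 1) →
            multNorm ⊤ (fun p : Rn n × Rn n =>
              ∑' μν : Zn n × Zn n, α μν.1 * α' μν.2 * σf μν.1 μν.2 p) ≤ (M : ℝ≥0∞)) →
        multNorm ⊤ (sigmaA (fun μ ν => ∫ p : Rn n × Rn n, σf μ ν p) Φ) ≤ c * M := by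
  obtain ⟨c, hc, hcb⟩ := exists_trigForm_bound n hK
  obtain ⟨hΦs, hΦc⟩ := hΦ
  obtain ⟨D, hD⟩ := hΦc.exists_bound_of_continuous hΦs.continuous
  obtain ⟨R, hR⟩ : ∃ R : ℝ, ∀ p, Φ p ≠ 0 → ‖p.1‖ ≤ R ∧ ‖p.2‖ ≤ R := by
    obtain ⟨R, hR⟩ := hΦc.isCompact.isBounded.exists_norm_le
    refine ⟨R, fun p hp => ?_⟩
    have := hR p (subset_tsupport _ hp)
    exact ⟨(norm_fst_le p).trans this, (norm_snd_le p).trans this⟩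
  obtain ⟨N, hN⟩ := exists_card_lattice_le n R
  refine ⟨ENNReal.ofReal D * volume (Metric.closedBall (0 : Rn n) R) * c * N, ?_, ?_⟩
  · have : volume (Metric.closedBall (0 : Rn n) R) ≠ ∞ := measure_closedBall_lt_top.ne
    finiteness
  rintro σf M hm ⟨C, hC⟩ hs hM
  have h : LocalizedFamily K C M σf := ⟨hm, hC, hs, hM⟩
  obtain ⟨b, hb⟩ := h.exists_integral_bound hK
  set B : Zn n → Zn n → ℂ := fun μ ν => ∫ p, σf μ ν p
  unfold multNorm
  refine iSup_le fun f => iSup_le fun g => iSup_le fun hf => iSup_le fun hg => ?_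
  simp only [amalgamNorm, if_true]
  refine iSup_le fun ρ => ?_
  set S : ℕ → Finset (Zn n) := fun m => Fintype.piFinset fun _ => Finset.Icc (-(m : ℤ)) m
  have hTc : ∀ m, Continuous (Tbil (sigmaTrunc B Φ (S m)) f g) := fun m =>
    continuous_Tbil (continuous_sigmaTrunc B hΦs.continuous _)
      (norm_sigmaTrunc_le hb hD hR hN _) f g
  have hlim : ∀ x, Filter.Tendsto (fun m => Tbil (sigmaTrunc B Φ (S m)) f g x) Filter.atTop
      (nhds (Tbil (sigmaA B Φ) f g x)) := by
    intro x
    have h1 : Integrable fun p : Rn n × Rn n => ft f p.1 * ft g p.2 :=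
      (integrable_ft f).mul_prod (integrable_ft g)
    refine tendsto_integral_of_dominated_convergence
      (fun p => N * (N * (b * D)) * ‖ft f p.1 * ft g p.2‖)
      (fun m => (integrable_Tbil (continuous_sigmaTrunc B hΦs.continuous _)
        (norm_sigmaTrunc_le hb hD hR hN _) f g x).aestronglyMeasurable) (h1.norm.const_mul _) ?_ ?_
    · refine fun m => Filter.Eventually.of_forall fun p => ?_
      change ‖chr x (p.1 + p.2) * sigmaTrunc B Φ (S m) p * ft f p.1 * ft g p.2‖ ≤ _
      rw [mul_assoc, norm_mul, norm_mul, norm_chr, one_mul]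
      gcongr
      exact norm_sigmaTrunc_le hb hD hR hN _ p
    · refine Filter.Eventually.of_forall fun p => ?_
      exact (((tendsto_sigmaTrunc B hR p).const_mul _).mul_const _).mul_const _
  have hbound : ∀ m, eLpNorm (fun t => Tbil (sigmaTrunc B Φ (S m)) f g (t + coeZ ρ)) 2
      (volume.restrict (cube n 1)) ≤
      ENNReal.ofReal D * volume (Metric.closedBall (0 : Rn n) R) * c * N * M := by
    intro m
    have := localL2_Tbil_sigmaTrunc_le (hcb h) hΦs.continuous hD hR hN (S m) f g ρ
    rwa [hf, hg, mul_one, mul_one, localL2_eq_eLpNorm] at this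
  rw [localL2_eq_eLpNorm]
  refine (Lp.eLpNorm_lim_le_liminf_eLpNorm
    (f := fun m t => Tbil (sigmaTrunc B Φ (S m)) f g (t + coeZ ρ)) (fun m => ?_) _
    (Filter.Eventually.of_forall fun t => hlim _)).trans ?_
  · exact ((hTc m).comp (continuous_add_const _)).aestronglyMeasurable
  · exact Filter.liminf_le_of_frequently_le' (Filter.Frequently.of_forall hbound)
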